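/- arXiv:1003.1659 — 3 statements merged into one kernel-verified Lean document; each statement's English description precedes it below -/
import Mathlib

section
/- Let p be a prime number and let K be a p-adic field, i.e. a finite-dimensional field extension of ℚ_p. Then every homogeneous polynomial of degree 2 in m variables with coefficients in K, where m ≥ 5, has a nontrivial zero: there exists x ∈ K^m with x ≠ 0 and f(x) = 0. -/
open scoped NormedField Valued

open QuadraticMap

/-- A ternary quadratic form over a finite field has a nontrivial zero. -/
theorem exists_ternary_quadratic_zero (k : Type*) [Field k] [Finite k] (a b c d e f : k) :
    ∃ x y z : k, (x ≠ 0 ∨ y ≠ 0 ∨ z ≠ 0) ∧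
      a * x ^ 2 + b * y ^ 2 + c * z ^ 2 + d * (x * y) + e * (x * z) + f * (y * z) = 0 := by
  classical
  have := Fintype.ofFinite k
  obtain ⟨p, hp⟩ := CharP.exists k
  have hprime : p.Prime := CharP.char_is_prime k p
  let F : MvPolynomial (Fin 3) k := ∑ i : Fin 6, MvPolynomial.C (![a, b, c, d, e, f] i) *
    (MvPolynomial.X (![0, 1, 2, 0, 0, 1] i) * MvPolynomial.X (![0, 1, 2, 1, 2, 2] i))
  have hF : F.totalDegree < Fintype.card (Fin 3) := by
    refine lt_of_le_of_lt (b := 2) ?_ (by simp)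
    refine MvPolynomial.totalDegree_finsetSum_le fun i _ ↦ ?_
    refine (MvPolynomial.totalDegree_mul _ _).trans ?_
    rw [MvPolynomial.totalDegree_C, zero_add]
    exact (MvPolynomial.totalDegree_mul _ _).trans (by simp)
  have hdvd := char_dvd_card_solutions p hF
  have hzero : MvPolynomial.eval 0 F = 0 := by simp [F]
  have hcard : 1 < Fintype.card { x : Fin 3 → k // MvPolynomial.eval x F = 0 } :=
    hprime.one_lt.trans_le (Nat.le_of_dvd (Fintype.card_pos_iff.mpr ⟨⟨0, hzero⟩⟩) hdvd)
  obtain ⟨⟨x, hx⟩, hne⟩ := Fintype.exists_ne_of_one_lt_card hcard ⟨0, hzero⟩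
  refine ⟨x 0, x 1, x 2, ?_, ?_⟩
  · by_contra! h
    apply hne
    ext i
    fin_cases i <;> simp [h]
  · simp only [F, Fin.sum_univ_six, map_add, map_mul, MvPolynomial.eval_C,
      MvPolynomial.eval_X] at hx
    simp at hx
    linear_combination hx

/-- A homogeneous polynomial of degree two defines a quadratic form. -/
theorem MvPolynomial.IsHomogeneous.exists_quadraticForm {σ R : Type*} [CommRing R]
    {f : MvPolynomial σ R} (hf : f.IsHomogeneous 2) :
    ∃ Q : QuadraticForm R (σ → R), ∀ x, Q x = MvPolynomial.eval x f := by
  classical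
  have key (d : σ →₀ ℕ) (hd : d ∈ f.support) :
      ∃ Q : QuadraticForm R (σ → R), ∀ x, Q x = d.prod fun i n ↦ x i ^ n := by
    have hdeg : (Finsupp.toMultiset d).card = 2 := by
      rw [Finsupp.card_toMultiset, ← hf (MvPolynomial.mem_support_iff.mp hd)]
      simp [Finsupp.weight_apply, Function.id_def]
    obtain ⟨i, j, hij⟩ := Multiset.card_eq_two.mp hdeg
    refine ⟨QuadraticMap.proj i j, fun x ↦ ?_⟩
    have h := Finsupp.prod_toMultiset (d.mapDomain x)
    rw [← Finsupp.toMultiset_map, hij,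
      Finsupp.prod_mapDomain_index (by simp) (by simp [pow_add])] at h
    simpa using h
  choose! Q hQ using key
  refine ⟨∑ d ∈ f.support, f.coeff d • Q d, fun x ↦ ?_⟩
  rw [MvPolynomial.eval_eq, sum_apply]
  exact Finset.sum_congr rfl fun d hd ↦ by simp [hQ d hd, Finsupp.prod]

namespace IsUltrametricDist

variable {K : Type*} [NontriviallyNormedField K] [IsUltrametricDist K] [ProperSpace K]

theorem norm_sub_le_max {G : Type*} [SeminormedAddCommGroup G] [IsUltrametricDist G] (x y : G) :
    ‖x - y‖ ≤ max ‖x‖ ‖y‖ := by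
  simpa [sub_eq_add_neg] using norm_add_le_max x (-y)

/-- The residue field of a locally compact nonarchimedean field is finite. -/
theorem finite_residueField : Finite 𝓀[K] := by
  have hc : CompactSpace 𝒪[K] := by
    have h : IsCompact {x : K | ‖x‖ ≤ 1} := by
      simpa [Metric.closedBall, dist_zero_right] using isCompact_closedBall (0 : K) 1
    refine (isCompact_iff_compactSpace (s := (𝒪[K] : Set K))).mp ?_
    convert h using 1
    ext x
    exact Valued.integer.mem_iff
  have ho : IsOpen ((𝓂[K]).toAddSubgroup : Set 𝒪[K]) := by
    have h : IsOpen {x : 𝒪[K] | ‖x‖ < 1} := isOpen_lt continuous_norm continuous_const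
    convert h using 1
    ext x
    have := Valued.integer.isUnit_iff_norm_eq_one (u := x)
    have := Valued.integer.norm_le_one x
    simp only [Submodule.coe_toAddSubgroup, SetLike.mem_coe, IsLocalRing.mem_maximalIdeal,
      mem_nonunits_iff, Set.mem_ofPred_eq]
    grind
  exact AddSubgroup.quotient_finite_of_isOpen _ ho

/-- The equation `s ^ 2 + s + c = 0` is soluble for `‖c‖ < 1`. -/
theorem exists_sq_add_self_add_eq_zero {c : K} (hc : ‖c‖ < 1) :
    ∃ s : K, ‖s‖ < 1 ∧ s ^ 2 + s + c = 0 := by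
  obtain ⟨s, hs, hmin⟩ := (isCompact_closedBall (0 : K) ‖c‖).exists_isMinOn
    ⟨0, by simp⟩ (f := fun s ↦ ‖s ^ 2 + s + c‖) (by fun_prop)
  rw [mem_closedBall_zero_iff] at hs
  refine ⟨s, hs.trans_lt hc, ?_⟩
  by_contra hne
  set h := s ^ 2 + s + c with hh
  have hsq : ‖s ^ 2‖ ≤ ‖c‖ := by
    rw [norm_pow]
    nlinarith [norm_nonneg s]
  have hle : ‖h‖ ≤ ‖c‖ :=
    (norm_add_le_max _ _).trans (max_le ((norm_add_le_max _ _).trans (max_le hsq hs)) le_rfl)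
  have hmem : s - h ∈ Metric.closedBall (0 : K) ‖c‖ := by
    rw [mem_closedBall_zero_iff]
    exact (norm_sub_le_max _ _).trans (max_le hs hle)
  have h1 : ‖h‖ ≤ ‖(s - h) ^ 2 + (s - h) + c‖ := hmin hmem
  have h2 : (s - h) ^ 2 + (s - h) + c = h * (h - s - s) := by
    linear_combination - hh
  have h3 : ‖h - s - s‖ < 1 := lt_of_le_of_lt
    ((norm_sub_le_max _ _).trans (max_le ((norm_sub_le_max _ _).trans (max_le hle hs)) hs)) hc
  rw [h2, norm_mul] at h1
  nlinarith [norm_pos_iff.mpr hne]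

/-- The absolute value of a locally compact nonarchimedean field is discrete. -/
theorem exists_norm_eq_zpow :
    ∃ ϖ : K, 0 < ‖ϖ‖ ∧ ∀ x : K, x ≠ 0 → ∃ n : ℤ, ‖x‖ = ‖ϖ‖ ^ n := by
  have hcl : IsClosed {x : K | ‖x‖ < 1} := by
    simpa [Metric.ball, dist_zero_right] using IsUltrametricDist.isClosed_ball (0 : K) 1
  have hcpt : IsCompact {x : K | ‖x‖ < 1} :=
    (isCompact_closedBall (0 : K) 1).of_isClosed_subset hcl fun x hx ↦ by
      simpa using le_of_lt hx
  obtain ⟨ϖ, hϖ, hmax⟩ := hcpt.exists_isMaxOn ⟨0, by simp⟩ continuous_norm.continuousOn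
  obtain ⟨t, ht0, ht1⟩ := NormedField.exists_norm_lt_one K
  have hpos : 0 < ‖ϖ‖ := ht0.trans_le (hmax ht1)
  refine ⟨ϖ, hpos, fun x hx ↦ ?_⟩
  obtain ⟨n, hn1, hn2⟩ := exists_mem_Ioc_zpow (norm_pos_iff.mpr hx) (one_lt_inv₀ hpos |>.mpr hϖ)
  refine ⟨-(n + 1), ?_⟩
  rw [inv_zpow'] at hn1 hn2
  refine hn2.antisymm (not_lt.mp fun hlt ↦ ?_)
  have h1 : ‖x * ϖ ^ (n + 1)‖ < 1 := by
    rw [norm_mul, norm_zpow]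
    rwa [zpow_neg, ← one_div, lt_div_iff₀ (by positivity)] at hlt
  have h2 : ‖x * ϖ ^ (n + 1)‖ ≤ ‖ϖ‖ := hmax h1
  rw [norm_mul, norm_zpow, zpow_add₀ hpos.ne', zpow_one, ← mul_assoc] at h2
  have h3 : ‖x‖ * ‖ϖ‖ ^ n ≤ 1 := le_of_mul_le_mul_right (by simpa using h2) hpos
  rw [zpow_neg, ← one_div, div_lt_iff₀ (by positivity)] at hn1
  linarith

end IsUltrametricDist

namespace QuadraticMap.Anisotropic

open IsUltrametricDist

variable {K : Type*} [NontriviallyNormedField K] [IsUltrametricDist K] [ProperSpace K]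
  {V : Type*} [AddCommGroup V] [Module K V] {Q : QuadraticForm K V}

/-- The polar form of an anisotropic form is bounded by the form itself. -/
theorem norm_polar_le (hQ : Q.Anisotropic) {r : ℝ} {x y : V} (hx : ‖Q x‖ ≤ r) (hy : ‖Q y‖ ≤ r) :
    ‖polar Q x y‖ ≤ r := by
  by_contra! hlt
  set B := polar Q x y with hB
  have hr : 0 ≤ r := (norm_nonneg _).trans hx
  have hB0 : B ≠ 0 := norm_pos_iff.mp (hr.trans_lt hlt)
  have hQx : Q x ≠ 0 := fun h ↦ hB0 <| by simp [hB, hQ x h]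
  have hc : ‖Q x * Q y / B ^ 2‖ < 1 := by
    rw [norm_div, norm_mul, norm_pow, div_lt_one (pow_pos (hr.trans_lt hlt) 2)]
    nlinarith [norm_nonneg (Q x), norm_nonneg (Q y)]
  obtain ⟨s, hs, hroot⟩ := exists_sq_add_self_add_eq_zero hc
  have hroot' : B ^ 2 * (s ^ 2 + s) + Q x * Q y = 0 := by
    field_simp at hroot
    linear_combination hroot
  have hzero : (B * s) • x + Q x • y = 0 := by
    apply hQ
    rw [QuadraticMap.map_add Q, QuadraticMap.map_smul, QuadraticMap.map_smul, polar_smul_left,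
      polar_smul_right, ← hB]
    simp only [smul_eq_mul]
    linear_combination Q x * hroot'
  have hpolar : polar Q ((B * s) • x + Q x • y) x = 0 := by simp [hzero]
  rw [polar_add_left, polar_smul_left, polar_smul_left, polar_self, polar_comm _ y x, ← hB]
    at hpolar
  simp only [smul_eq_mul, nsmul_eq_mul] at hpolar
  have hss : s + s = -1 := by
    apply mul_left_cancel₀ (mul_ne_zero hB0 hQx)
    push_cast at hpolar
    linear_combination hpolar
  have h1 : ‖s + s‖ < 1 := (norm_add_le_max s s).trans_lt (by simpa using hs)
  simp [hss] at h1

theorem norm_map_add_le_max (hQ : Q.Anisotropic) (x y : V) :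
    ‖Q (x + y)‖ ≤ max ‖Q x‖ ‖Q y‖ := by
  rw [QuadraticMap.map_add Q]
  exact (norm_add_le_max _ _).trans <| max_le (norm_add_le_max _ _)
    (hQ.norm_polar_le (le_max_left _ _) (le_max_right _ _))

theorem norm_map_add_lt (hQ : Q.Anisotropic) {r : ℝ} {x y : V} (hx : ‖Q x‖ < r)
    (hy : ‖Q y‖ < r) : ‖Q (x + y)‖ < r :=
  (hQ.norm_map_add_le_max x y).trans_lt (max_lt hx hy)

/-- Three vectors on which an anisotropic form has the same absolute value are linearly dependent
modulo vectors on which the form is smaller. -/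
theorem exists_norm_map_smul_add_lt (hQ : Q.Anisotropic) {r : ℝ} {x y z : V} (hr : 0 < r)
    (hx : ‖Q x‖ = r) (hy : ‖Q y‖ = r) (hz : ‖Q z‖ = r) :
    ∃ a b c : K, ‖a‖ ≤ 1 ∧ ‖b‖ ≤ 1 ∧ ‖c‖ ≤ 1 ∧ (‖a‖ = 1 ∨ ‖b‖ = 1 ∨ ‖c‖ = 1) ∧
      ‖Q (a • x + b • y + c • z)‖ < r := by
  have := finite_residueField (K := K)
  have hx0 : Q x ≠ 0 := norm_pos_iff.mp (hx ▸ hr)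
  have key (t : K) (ht : ‖t‖ ≤ r) : t / Q x ∈ 𝒪[K] := by
    rw [Valued.integer.mem_iff, norm_div, hx]
    exact div_le_one_of_le₀ ht hr.le
  let A : 𝒪[K] := ⟨_, key _ hx.le⟩
  let B : 𝒪[K] := ⟨_, key _ hy.le⟩
  let C : 𝒪[K] := ⟨_, key _ hz.le⟩
  let D : 𝒪[K] := ⟨_, key _ (hQ.norm_polar_le hx.le hy.le)⟩
  let E : 𝒪[K] := ⟨_, key _ (hQ.norm_polar_le hx.le hz.le)⟩
  let F : 𝒪[K] := ⟨_, key _ (hQ.norm_polar_le hy.le hz.le)⟩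
  let res := IsLocalRing.residue 𝒪[K]
  obtain ⟨a, b, c, hne, h⟩ := exists_ternary_quadratic_zero 𝓀[K] (res A) (res B) (res C)
    (res D) (res E) (res F)
  obtain ⟨a, rfl⟩ := IsLocalRing.residue_surjective a
  obtain ⟨b, rfl⟩ := IsLocalRing.residue_surjective b
  obtain ⟨c, rfl⟩ := IsLocalRing.residue_surjective c
  have hunit (t : 𝒪[K]) : res t ≠ 0 → ‖(t : K)‖ = 1 := fun ht ↦
    Valued.integer.isUnit_iff_norm_eq_one.mp ((IsLocalRing.residue_ne_zero_iff_isUnit t).mp ht)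
  refine ⟨a, b, c, Valued.integer.norm_le_one a, Valued.integer.norm_le_one b,
    Valued.integer.norm_le_one c, hne.imp (hunit a) (Or.imp (hunit b) (hunit c)), ?_⟩
  simp only [res, ← map_mul, ← map_pow, ← map_add] at h
  rw [IsLocalRing.residue_eq_zero_iff, IsLocalRing.mem_maximalIdeal, mem_nonunits_iff,
    Valued.integer.isUnit_iff_norm_eq_one] at h
  have hlt := lt_of_le_of_ne (Valued.integer.norm_le_one _) h
  set T : 𝒪[K] := A * a ^ 2 + B * b ^ 2 + C * c ^ 2 + D * (a * b) + E * (a * c) + F * (b * c)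
    with hT
  have hval : Q ((a : K) • x + (b : K) • y + (c : K) • z) = Q x * T := by
    simp only [QuadraticMap.map_add Q, QuadraticMap.map_smul, polar_add_left, polar_smul_left,
      polar_smul_right, smul_eq_mul, hT, A, B, C, D, E, F]
    push_cast
    field_simp
    ring
  rw [hval, norm_mul, hx]
  exact mul_lt_of_lt_one_right hr hlt

/-- Vectors on which an anisotropic form has a given absolute value are generated by two vectors,
modulo vectors on which the form is smaller. -/
theorem exists_pair_norm_map_sub_lt (hQ : Q.Anisotropic) {r : ℝ} (hr : 0 < r) :
    ∃ x y : V, ∀ z, ‖Q z‖ = r → ∃ a b : K, ‖Q (z - (a • x + b • y))‖ < r := by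
  by_cases hS : ∃ x, ‖Q x‖ = r
  swap
  · exact ⟨0, 0, fun z hz ↦ (hS ⟨z, hz⟩).elim⟩
  obtain ⟨x, hx⟩ := hS
  by_cases hT : ∃ y, ‖Q y‖ = r ∧ ∀ a : K, r ≤ ‖Q (y - a • x)‖
  swap
  · push Not at hT
    refine ⟨x, 0, fun z hz ↦ ?_⟩
    obtain ⟨a, ha⟩ := hT z hz
    exact ⟨a, 0, by simpa using ha⟩
  obtain ⟨y, hy, hxy⟩ := hT
  refine ⟨x, y, fun z hz ↦ ?_⟩
  obtain ⟨a, b, c, ha, hb, hc, hunit, hlt⟩ := hQ.exists_norm_map_smul_add_lt hr hx hy hz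
  have hsmul (t : K) (v : V) (hv : ‖Q v‖ = r) (ht : ‖t‖ ≤ 1) (ht' : ‖t‖ ≠ 1) :
      ‖Q (-(t • v))‖ < r := by
    rw [QuadraticMap.map_neg, QuadraticMap.map_smul, smul_eq_mul, norm_mul, norm_mul, hv]
    have := lt_of_le_of_ne ht ht'
    nlinarith [norm_nonneg t, mul_lt_of_lt_one_right hr this]
  have hscale (t : K) (v : V) (ht : ‖t‖ = 1) : ‖Q (t⁻¹ • v)‖ = ‖Q v‖ := by
    simp [QuadraticMap.map_smul, ht]
  by_cases hc1 : ‖c‖ = 1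
  · have hc0 : c ≠ 0 := norm_ne_zero_iff.mp (by simp [hc1])
    refine ⟨-(c⁻¹ * a), -(c⁻¹ * b), ?_⟩
    have hz' : z - (-(c⁻¹ * a) • x + -(c⁻¹ * b) • y) = c⁻¹ • (a • x + b • y + c • z) := by
      simp only [smul_add, smul_smul, inv_mul_cancel₀ hc0]
      module
    rwa [hz', hscale c _ hc1]
  exfalso
  have hlt' := hQ.norm_map_add_lt hlt (hsmul c z hz hc hc1)
  rw [add_neg_cancel_right] at hlt'
  by_cases hb1 : ‖b‖ = 1
  · have hb0 : b ≠ 0 := norm_ne_zero_iff.mp (by simp [hb1])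
    refine (hxy (-(b⁻¹ * a))).not_gt ?_
    have hy' : y - -(b⁻¹ * a) • x = b⁻¹ • (a • x + b • y) := by
      simp only [smul_add, smul_smul, inv_mul_cancel₀ hb0]
      module
    rwa [hy', hscale b _ hb1]
  have hlt'' := hQ.norm_map_add_lt hlt' (hsmul b y hy hb hb1)
  rw [add_neg_cancel_right, QuadraticMap.map_smul] at hlt''
  have ha1 : ‖a‖ = 1 := by tauto
  simp [ha1, hx] at hlt''

/-- An anisotropic form is coercive. -/
theorem exists_mul_sq_norm_le {ι : Type*} [Fintype ι] {Q : QuadraticForm K (ι → K)}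
    (hQ : Q.Anisotropic) (hcont : Continuous Q) :
    ∃ ε > 0, ∀ x, ε * ‖x‖ ^ 2 ≤ ‖Q x‖ := by
  rcases isEmpty_or_nonempty ι with hι | hι
  · exact ⟨1, one_pos, fun x ↦ by simp [Subsingleton.elim x 0]⟩
  obtain ⟨u, hu, hmin⟩ := (isCompact_sphere (0 : ι → K) 1).exists_isMinOn
    ⟨1, by simp⟩ (f := fun x ↦ ‖Q x‖) (by fun_prop)
  have hu0 : u ≠ 0 := by
    rintro rfl
    simp at hu
  refine ⟨‖Q u‖, norm_pos_iff.mpr fun h ↦ hu0 (hQ u h), fun x ↦ ?_⟩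
  obtain ⟨i, hi⟩ : ∃ i, ‖x‖ = ‖x i‖ := by
    obtain ⟨i, -, hi⟩ := Finset.exists_mem_eq_sup Finset.univ Finset.univ_nonempty
      fun i ↦ ‖x i‖₊
    exact ⟨i, by rw [Pi.norm_def, hi, coe_nnnorm]⟩
  rcases eq_or_ne (x i) 0 with h0 | h0
  · simp [hi, h0]
  have hpos := norm_pos_iff.mpr h0
  have h := hmin (show (x i)⁻¹ • x ∈ Metric.sphere 0 1 by
    rw [mem_sphere_zero_iff_norm, norm_smul, norm_inv, hi, inv_mul_cancel₀ hpos.ne'])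
  simp only [Set.mem_ofPred_eq, QuadraticMap.map_smul, smul_eq_mul, norm_mul, norm_inv] at h
  rw [hi]
  field_simp at h
  exact h

/-- An anisotropic quadratic form over a locally compact nonarchimedean field has at most four
variables. -/
theorem card_le_four {ι : Type*} [Fintype ι] {Q : QuadraticForm K (ι → K)}
    (hQ : Q.Anisotropic) (hcont : Continuous Q) : Fintype.card ι ≤ 4 := by
  classical
  obtain ⟨ϖ, hpos, hϖ⟩ := exists_norm_eq_zpow (K := K)
  obtain ⟨ε, hε, hcoer⟩ := hQ.exists_mul_sq_norm_le hcont
  obtain ⟨x₀, y₀, h₀⟩ := hQ.exists_pair_norm_map_sub_lt one_pos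
  obtain ⟨x₁, y₁, h₁⟩ := hQ.exists_pair_norm_map_sub_lt hpos
  let S : Finset (ι → K) := {x₀, y₀, x₁, y₁}
  let W : Submodule K (ι → K) := Submodule.span K S
  have hred (r : ℝ) (hr : r = 1 ∨ r = ‖ϖ‖) (z : ι → K) (hz : ‖Q z‖ = r) :
      ∃ w ∈ W, ‖Q (z - w)‖ < r := by
    have hmem (v : ι → K) (hv : v ∈ S) : v ∈ W := Submodule.subset_span hv
    rcases hr with rfl | rfl
    · obtain ⟨a, b, hab⟩ := h₀ z hz
      exact ⟨_, W.add_mem (W.smul_mem a (hmem x₀ (by simp [S])))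
        (W.smul_mem b (hmem y₀ (by simp [S]))), hab⟩
    · obtain ⟨a, b, hab⟩ := h₁ z hz
      exact ⟨_, W.add_mem (W.smul_mem a (hmem x₁ (by simp [S])))
        (W.smul_mem b (hmem y₁ (by simp [S]))), hab⟩
  have hW : W = ⊤ := by
    refine Submodule.eq_top_iff'.mpr fun v ↦ ?_
    have : ProperSpace W := FiniteDimensional.proper K W
    have htend : Filter.Tendsto (fun w : W ↦ ‖Q (v - w)‖) (Filter.cocompact W) Filter.atTop := by
      refine Filter.tendsto_atTop_mono (fun w ↦ hcoer _) ?_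
      refine Filter.Tendsto.const_mul_atTop hε ((Filter.tendsto_pow_atTop two_ne_zero).comp ?_)
      refine Filter.tendsto_atTop_mono (f := fun w : W ↦ ‖w‖ - ‖v‖) (fun w ↦ ?_)
        (Filter.tendsto_atTop_add_const_right _ _ (tendsto_norm_cocompact_atTop (E := W)))
      rw [norm_sub_rev]
      exact norm_sub_norm_le (w : ι → K) v
    obtain ⟨w, hw⟩ := Continuous.exists_forall_le (by fun_prop) htend
    by_contra hv
    have hne : Q (v - w) ≠ 0 := fun h ↦ hv <| by
      rw [sub_eq_zero.mp (hQ _ h)]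
      exact w.2
    obtain ⟨n, hn⟩ := hϖ _ hne
    obtain ⟨j, hj⟩ := Int.even_or_odd' n
    have hϖ0 : ϖ ≠ 0 := norm_pos_iff.mp hpos
    let t : K := ϖ ^ (-j)
    have ht0 : t ≠ 0 := zpow_ne_zero _ hϖ0
    have hscale (u : ι → K) : ‖Q (t • u)‖ = ‖t‖ * ‖t‖ * ‖Q u‖ := by
      simp [QuadraticMap.map_smul]
    have ht : ‖t‖ * ‖t‖ * ‖Q (v - w)‖ = 1 ∨ ‖t‖ * ‖t‖ * ‖Q (v - w)‖ = ‖ϖ‖ := by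
      rw [hn, norm_zpow, ← zpow_add₀ hpos.ne', ← zpow_add₀ hpos.ne']
      rcases hj with rfl | rfl
      · left
        rw [show -j + -j + 2 * j = 0 by ring, zpow_zero]
      · right
        rw [show -j + -j + (2 * j + 1) = 1 by ring, zpow_one]
    obtain ⟨w', hw', hlt⟩ := hred _ ht _ (hscale _)
    have hfact : t • (v - (w : ι → K)) - w' =
        t • (v - ((w + t⁻¹ • ⟨w', hw'⟩ : W) : ι → K)) := by
      simp only [Submodule.coe_add, Submodule.coe_smul, smul_sub, smul_add, smul_smul,
        mul_inv_cancel₀ ht0, one_smul]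
      abel
    rw [hfact, hscale] at hlt
    exact (hw _).not_gt (lt_of_mul_lt_mul_left hlt (by positivity))
  calc Fintype.card ι = Module.finrank K (ι → K) := (Module.finrank_fintype_fun_eq_card K).symm
    _ = Module.finrank K W := by rw [hW, finrank_top]
    _ ≤ S.card := finrank_span_finset_le_card S
    _ ≤ 4 := Finset.card_le_four

end QuadraticMap.Anisotropic

/-- **Hasse**. Every quadratic form in at least `5` variables over a `p`-adic field
(a finite-dimensional field extension of `ℚ_p`) has a nontrivial zero. -/
theorem hasse_quadratic_forms_padic (p : ℕ) [Fact p.Prime]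
    (K : Type*) [Field K] [Algebra ℚ_[p] K] [FiniteDimensional ℚ_[p] K]
    (m : ℕ) (hm : 5 ≤ m)
    (f : MvPolynomial (Fin m) K) (hf : f.IsHomogeneous 2) :
    ∃ x : Fin m → K, x ≠ 0 ∧ MvPolynomial.eval x f = 0 := by
  let : NontriviallyNormedField K := spectralNorm.nontriviallyNormedField ℚ_[p] K
  let : NormedSpace ℚ_[p] K := spectralNorm.normedSpace ℚ_[p] K
  have : IsUltrametricDist K :=
    IsUltrametricDist.isUltrametricDist_of_isNonarchimedean_norm
      (isNonarchimedean_spectralNorm (K := ℚ_[p]) (L := K))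
  have : ProperSpace K := FiniteDimensional.proper ℚ_[p] K
  obtain ⟨Q, hQ⟩ := hf.exists_quadraticForm
  by_contra! h
  have haniso : Q.Anisotropic := fun x hx ↦ by
    by_contra hx0
    exact h x hx0 (hQ x ▸ hx)
  have hcont : Continuous Q := by
    rw [funext hQ]
    exact f.continuous_eval
  have := haniso.card_le_four hcont
  rw [Fintype.card_fin] at this
  omega
end

section
/- Let p be a prime number and let K be a p-adic field, i.e. a finite-dimensional field extension of ℚ_p. Then every homogeneous polynomial of degree 3 in m variables with coefficients in K, where m ≥ 10, has a nontrivial zero: there exists x ∈ K^m with x ≠ 0 and f(x) = 0. -/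
open Polynomial in
/-- The Newton polygon of an irreducible monic polynomial is a single segment. -/
theorem norm_coeff_pow_le_of_irreducible {K : Type*} [NontriviallyNormedField K]
    [IsUltrametricDist K] [CompleteSpace K] {P : K[X]} (hP : P.Monic) (hirr : Irreducible P)
    {i : ℕ} (hi : i < P.natDegree) :
    ‖P.coeff i‖ ^ P.natDegree ≤ ‖P.coeff 0‖ ^ (P.natDegree - i) := by
  have : Fact (Irreducible P) := ⟨hirr⟩
  have : FiniteDimensional K (AdjoinRoot P) := (AdjoinRoot.powerBasis hirr.ne_zero).finite
  have hmin : minpoly K (AdjoinRoot.root P) = P := by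
    rw [AdjoinRoot.minpoly_root hirr.ne_zero, hP.leadingCoeff, inv_one, map_one, mul_one]
  have hval := spectralNorm.spectralNorm_eq_norm_coeff_zero_rpow K _ (AdjoinRoot.root P)
  have hle := le_ciSup (spectralValueTerms_bddAbove P) i
  rw [spectralNorm, hmin] at hval
  change _ ≤ spectralValue P at hle
  rw [hval, spectralValueTerms_of_lt_natDegree P hi] at hle
  have hd : (P.natDegree : ℝ) ≠ 0 := by exact_mod_cast (by lia : P.natDegree ≠ 0)
  have hs : (P.natDegree : ℝ) - i ≠ 0 := sub_ne_zero.2 (by exact_mod_cast hi.ne')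
  have key := pow_le_pow_left₀ (by positivity) hle (P.natDegree * (P.natDegree - i))
  rw [← Real.rpow_mul_natCast (norm_nonneg _), ← Real.rpow_mul_natCast (norm_nonneg _)] at key
  rw [← Real.rpow_natCast, ← Real.rpow_natCast]
  rw [Nat.cast_mul, Nat.cast_sub hi.le] at key
  rw [Nat.cast_sub hi.le]
  have h₁ : 1 / ((P.natDegree : ℝ) - i) * (P.natDegree * (P.natDegree - i)) = P.natDegree := by
    field_simp
  have h₂ : 1 / (P.natDegree : ℝ) * (P.natDegree * (P.natDegree - i)) = P.natDegree - i := by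
    field_simp
  rwa [h₁, h₂] at key

open Polynomial in
/-- A bound for the linear coefficient of a cubic polynomial without roots. -/
theorem norm_pow_three_le_of_cubic_no_root {K : Type*} [NontriviallyNormedField K]
    [IsUltrametricDist K] [CompleteSpace K] {a b c d : K} (ha : a ≠ 0)
    (h : ∀ t : K, a * t ^ 3 + b * t ^ 2 + c * t + d ≠ 0) :
    ‖c‖ ^ 3 ≤ ‖a‖ * ‖d‖ ^ 2 := by
  let P : Cubic K := ⟨1, b / a, c / a, d / a⟩
  have hm : P.toPoly.Monic := Cubic.monic_of_a_eq_one rfl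
  have hdeg : P.toPoly.natDegree = 3 := Cubic.natDegree_of_a_ne_zero one_ne_zero
  have hirr : Irreducible P.toPoly := by
    rw [irreducible_iff_roots_eq_zero_of_degree_le_three (by lia) (by lia)]
    refine Multiset.eq_zero_of_forall_notMem fun t ht => h t ?_
    have ht' : P.toPoly.eval t = 0 := (mem_roots'.1 ht).2
    simp only [Cubic.toPoly, P, eval_add, eval_mul, eval_C, eval_pow, eval_X] at ht'
    field_simp at ht'
    linear_combination ht'
  have key := norm_coeff_pow_le_of_irreducible hm hirr (i := 1) (by lia)
  rw [hdeg, Cubic.coeff_eq_c, Cubic.coeff_eq_d] at key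
  simp only [P, norm_div, div_pow, Nat.reduceSub] at key
  have : 0 < ‖a‖ := norm_pos_iff.2 ha
  field_simp at key
  linarith

open scoped NormedField Valued in
theorem finite_residueField_of_properSpace (K : Type*) [NontriviallyNormedField K]
    [IsUltrametricDist K] [ProperSpace K] : Finite 𝓀[K] := by
  obtain ⟨t, hts, htf, hcover⟩ := (isCompact_closedBall (0 : K) 1).finite_cover_balls one_pos
  have htf' : (Subtype.val ⁻¹' t : Set 𝒪[K]).Finite := htf.preimage Subtype.val_injective.injOn
  refine Set.finite_univ_iff.1 ((htf'.image (IsLocalRing.residue 𝒪[K])).subset fun z _ => ?_)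
  obtain ⟨x, rfl⟩ := IsLocalRing.residue_surjective z
  obtain ⟨y, hyt, hy⟩ := Set.mem_iUnion₂.1 (hcover (show (x : K) ∈ Metric.closedBall 0 1 by
    simpa using Valued.integer.norm_le_one x))
  have hy1 : y ∈ 𝒪[K] := Valued.integer.mem_iff.2 (by simpa using hts hyt)
  refine ⟨⟨y, hy1⟩, hyt, ?_⟩
  rw [← sub_eq_zero, ← map_sub, ← not_ne_iff, IsLocalRing.residue_ne_zero_iff_isUnit,
    Valued.integer.isUnit_iff_norm_eq_one]
  rw [Metric.mem_ball, dist_comm, dist_eq_norm] at hy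
  exact hy.ne

theorem exists_uniformizer_of_properSpace (K : Type*) [NontriviallyNormedField K]
    [IsUltrametricDist K] [ProperSpace K] :
    ∃ ϖ : K, ϖ ≠ 0 ∧ ‖ϖ‖ < 1 ∧ ∀ x : K, ‖x‖ < 1 → ‖x‖ ≤ ‖ϖ‖ := by
  have hc : IsCompact (Metric.ball (0 : K) 1) :=
    (isCompact_closedBall (0 : K) 1).of_isClosed_subset (IsUltrametricDist.isClosed_ball 0 1)
      Metric.ball_subset_closedBall
  obtain ⟨ϖ, hϖ, hmax⟩ := hc.exists_isMaxOn ⟨0, by simp⟩ continuous_norm.continuousOn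
  have hmax' : ∀ x : K, ‖x‖ < 1 → ‖x‖ ≤ ‖ϖ‖ := fun x hx => hmax (by simpa using hx)
  obtain ⟨x, hx0, hx1⟩ := NormedField.exists_norm_lt_one K
  exact ⟨ϖ, norm_pos_iff.1 (hx0.trans_le (hmax' x hx1)), by simpa using hϖ, hmax'⟩

open scoped NormedField Valued in
/-- A quaternary cubic form with integral coefficients has a primitive zero modulo the maximal
ideal. -/
theorem exists_primitive_zero_mod_maximalIdeal {K : Type*} [NontriviallyNormedField K]
    [IsUltrametricDist K] [ProperSpace K] (e : Fin 4 → Fin 4 → Fin 4 → K)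
    (he : ∀ i j k, ‖e i j k‖ ≤ 1) :
    ∃ a : Fin 4 → K, (∀ i, ‖a i‖ ≤ 1) ∧ (∃ i, ‖a i‖ = 1) ∧
      ‖∑ i, ∑ j, ∑ k, e i j k * (a i * a j * a k)‖ < 1 := by
  classical
  have := finite_residueField_of_properSpace K
  let : Fintype 𝓀[K] := Fintype.ofFinite _
  let e' : Fin 4 → Fin 4 → Fin 4 → 𝒪[K] := fun i j k =>
    ⟨e i j k, Valued.integer.mem_iff.2 (he i j k)⟩
  let G : MvPolynomial (Fin 4) 𝓀[K] := ∑ i, ∑ j, ∑ k,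
    MvPolynomial.C (IsLocalRing.residue _ (e' i j k)) *
      (MvPolynomial.X i * MvPolynomial.X j * MvPolynomial.X k)
  have hG : G.IsHomogeneous 3 :=
    MvPolynomial.IsHomogeneous.sum _ _ _ fun i _ => MvPolynomial.IsHomogeneous.sum _ _ _ fun j _ =>
      MvPolynomial.IsHomogeneous.sum _ _ _ fun k _ =>
        (MvPolynomial.isHomogeneous_C _ _).mul (((MvPolynomial.isHomogeneous_X _ i).mul
          (MvPolynomial.isHomogeneous_X _ j)).mul (MvPolynomial.isHomogeneous_X _ k))
  have hdvd := char_dvd_card_solutions (ringChar 𝓀[K]) (f := G)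
    (hG.totalDegree_le.trans_lt (by simp))
  have hcard : 1 < Fintype.card {x : Fin 4 → 𝓀[K] // MvPolynomial.eval x G = 0} := by
    have : Nonempty {x : Fin 4 → 𝓀[K] // MvPolynomial.eval x G = 0} := ⟨0, by simp [G]⟩
    exact (CharP.char_is_prime 𝓀[K] (ringChar 𝓀[K])).one_lt.trans_le
      (Nat.le_of_dvd Fintype.card_pos hdvd)
  obtain ⟨⟨x, hx⟩, hx0⟩ := Fintype.exists_ne_of_one_lt_card hcard ⟨0, by simp [G]⟩
  obtain ⟨i, hi⟩ : ∃ i, x i ≠ 0 := Function.ne_iff.1 fun h => hx0 (Subtype.ext h)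
  choose a ha using fun i => IsLocalRing.residue_surjective (x i)
  refine ⟨fun i => a i, fun i => Valued.integer.norm_le_one (a i), ⟨i, ?_⟩, ?_⟩
  · rw [← ha, IsLocalRing.residue_ne_zero_iff_isUnit] at hi
    exact Valued.integer.isUnit_iff_norm_eq_one.1 hi
  · have hz : IsLocalRing.residue 𝒪[K] (∑ i, ∑ j, ∑ k, e' i j k * (a i * a j * a k)) = 0 := by
      simpa [G, ha] using hx
    have hnu : ¬ IsUnit (∑ i, ∑ j, ∑ k, e' i j k * (a i * a j * a k)) := fun h =>
      (IsLocalRing.residue_ne_zero_iff_isUnit _).2 h hz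
    rw [Valued.integer.isUnit_iff_norm_eq_one] at hnu
    have := lt_of_le_of_ne (Valued.integer.norm_le_one _) hnu
    simpa [e'] using this

section Cubic

variable {K V : Type*} [Field K] [AddCommGroup V] [Module K V]
  (B : V →ₗ[K] V →ₗ[K] V →ₗ[K] K)

/-- The cubic form attached to a trilinear form. -/
def cubicForm (x : V) : K := B x x x

/-- The part of `cubicForm B (x + y)` of degree two in `x` and one in `y`. -/
def cubicPolar (x y : V) : K := B x x y + B x y x + B y x x

/-- The symmetrization of a trilinear form. -/
def cubicPolar₃ (x y z : V) : K :=
  B x y z + B x z y + B y x z + B y z x + B z x y + B z y x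

theorem cubicForm_smul (t : K) (x : V) : cubicForm B (t • x) = t ^ 3 * cubicForm B x := by
  simp only [cubicForm, map_smul, LinearMap.smul_apply, smul_eq_mul]
  ring

theorem cubicForm_neg (x : V) : cubicForm B (-x) = -cubicForm B x := by
  simp [cubicForm]

theorem cubicForm_add (x y : V) : cubicForm B (x + y) =
    cubicForm B x + cubicPolar B x y + cubicPolar B y x + cubicForm B y := by
  simp only [cubicForm, cubicPolar, map_add, LinearMap.add_apply]
  ring

theorem cubicForm_add_smul (x y : V) (t : K) : cubicForm B (x + t • y) =
    cubicForm B y * t ^ 3 + cubicPolar B y x * t ^ 2 + cubicPolar B x y * t + cubicForm B x := by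
  simp only [cubicForm, cubicPolar, map_add, map_smul, LinearMap.add_apply, LinearMap.smul_apply,
    smul_eq_mul]
  ring

theorem cubicPolar₃_eq (x y z : V) : cubicPolar₃ B x y z =
    cubicForm B (x + y + z) - cubicForm B (x + y) - cubicForm B (y + z) - cubicForm B (x + z)
      + cubicForm B x + cubicForm B y + cubicForm B z := by
  simp only [cubicForm, cubicPolar₃, map_add, LinearMap.add_apply]
  ring

/-- The coefficients of a cubic form restricted to the span of a finite family. -/
def cubicCoeff {n : ℕ} (x : Fin n → V) (i j k : Fin n) : K :=
  if i = j then if j = k then cubicForm B (x i) else cubicPolar B (x i) (x k)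
  else if i < j ∧ j < k then cubicPolar₃ B (x i) (x j) (x k) else 0

theorem cubicForm_sum_smul (x : Fin 4 → V) (a : Fin 4 → K) : cubicForm B (∑ i, a i • x i) =
    ∑ i, ∑ j, ∑ k, cubicCoeff B x i j k * (a i * a j * a k) := by
  simp only [Fin.sum_univ_four, cubicCoeff, Fin.reduceEq, Fin.reduceLT, if_true, if_false,
    and_true, and_false, zero_mul, add_zero, zero_add]
  simp only [cubicForm, cubicPolar, cubicPolar₃, map_add, map_smul, LinearMap.add_apply,
    LinearMap.smul_apply, smul_eq_mul]
  ring

end Cubic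

section AnisotropicCubic

variable {K V : Type*} [NontriviallyNormedField K] [IsUltrametricDist K] [AddCommGroup V]
  [Module K V] {B : V →ₗ[K] V →ₗ[K] V →ₗ[K] K}

theorem norm_cubicPolar_pow_three_le [CompleteSpace K] (hB : ∀ x, cubicForm B x = 0 → x = 0)
    (x y : V) : ‖cubicPolar B x y‖ ^ 3 ≤ ‖cubicForm B y‖ * ‖cubicForm B x‖ ^ 2 := by
  by_cases hy : cubicForm B y = 0
  · simp [hB y hy, cubicPolar, cubicForm]
  by_cases h : ∃ t : K, cubicForm B (x + t • y) = 0
  · obtain ⟨t, ht⟩ := h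
    obtain rfl : x = (-t) • y := by
      rw [neg_smul]
      exact eq_neg_of_add_eq_zero_left (hB _ ht)
    have h3 : ‖(3 : K)‖ ≤ 1 := by exact_mod_cast IsUltrametricDist.norm_natCast_le_one K 3
    have hp : cubicPolar B ((-t) • y) y = 3 * (t ^ 2 * cubicForm B y) := by
      simp only [cubicForm, cubicPolar, map_smul, LinearMap.smul_apply, smul_eq_mul]
      ring
    rw [hp, cubicForm_smul]
    simp only [norm_mul, norm_pow, norm_neg]
    calc (‖(3 : K)‖ * (‖t‖ ^ 2 * ‖cubicForm B y‖)) ^ 3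
        ≤ (1 * (‖t‖ ^ 2 * ‖cubicForm B y‖)) ^ 3 := by gcongr
      _ = _ := by ring
  · push Not at h
    simp only [cubicForm_add_smul] at h
    exact norm_pow_three_le_of_cubic_no_root hy h

theorem norm_cubicPolar_le [CompleteSpace K] (hB : ∀ x, cubicForm B x = 0 → x = 0)
    {x y : V} {r : ℝ} (hx : ‖cubicForm B x‖ ≤ r) (hy : ‖cubicForm B y‖ ≤ r) :
    ‖cubicPolar B x y‖ ≤ r := by
  have hr : 0 ≤ r := (norm_nonneg _).trans hx
  refine le_of_pow_le_pow_left₀ three_ne_zero hr ((norm_cubicPolar_pow_three_le hB x y).trans ?_)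
  calc ‖cubicForm B y‖ * ‖cubicForm B x‖ ^ 2 ≤ r * r ^ 2 := by gcongr
    _ = r ^ 3 := by ring

theorem norm_cubicForm_add_le [CompleteSpace K] (hB : ∀ x, cubicForm B x = 0 → x = 0) (x y : V) :
    ‖cubicForm B (x + y)‖ ≤ max ‖cubicForm B x‖ ‖cubicForm B y‖ := by
  have hx := le_max_left ‖cubicForm B x‖ ‖cubicForm B y‖
  have hy := le_max_right ‖cubicForm B x‖ ‖cubicForm B y‖
  rw [cubicForm_add]
  refine (IsUltrametricDist.norm_add_le_max _ _).trans (max_le ?_ hy)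
  refine (IsUltrametricDist.norm_add_le_max _ _).trans (max_le ?_ (norm_cubicPolar_le hB hy hx))
  exact (IsUltrametricDist.norm_add_le_max _ _).trans (max_le hx (norm_cubicPolar_le hB hx hy))

theorem norm_cubicPolar₃_le [CompleteSpace K] (hB : ∀ x, cubicForm B x = 0 → x = 0)
    {x y z : V} {r : ℝ} (hx : ‖cubicForm B x‖ ≤ r) (hy : ‖cubicForm B y‖ ≤ r)
    (hz : ‖cubicForm B z‖ ≤ r) : ‖cubicPolar₃ B x y z‖ ≤ r := by
  have hadd : ∀ {u v : V}, ‖cubicForm B u‖ ≤ r → ‖cubicForm B v‖ ≤ r →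
      ‖cubicForm B (u + v)‖ ≤ r := fun hu hv =>
    (norm_cubicForm_add_le hB _ _).trans (max_le hu hv)
  have hK : ∀ {u v : K}, ‖u‖ ≤ r → ‖v‖ ≤ r → ‖u + v‖ ≤ r := fun hu hv =>
    (IsUltrametricDist.norm_add_le_max _ _).trans (max_le hu hv)
  have hK' : ∀ {u v : K}, ‖u‖ ≤ r → ‖v‖ ≤ r → ‖u - v‖ ≤ r := fun hu hv =>
    sub_eq_add_neg (G := K) _ _ ▸ hK hu (by rwa [norm_neg])
  rw [cubicPolar₃_eq]
  exact hK (hK (hK (hK' (hK' (hK' (hadd (hadd hx hy) hz) (hadd hx hy)) (hadd hy hz))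
    (hadd hx hz)) hx) hy) hz

theorem norm_cubicCoeff_le [CompleteSpace K] (hB : ∀ x, cubicForm B x = 0 → x = 0) {n : ℕ}
    {x : Fin n → V} {r : ℝ} (hx : ∀ i, ‖cubicForm B (x i)‖ ≤ r) (i j k : Fin n) :
    ‖cubicCoeff B x i j k‖ ≤ r := by
  unfold cubicCoeff
  split_ifs
  · exact hx i
  · exact norm_cubicPolar_le hB (hx i) (hx k)
  · exact norm_cubicPolar₃_le hB (hx i) (hx j) (hx k)
  · simpa using (norm_nonneg _).trans (hx i)

variable [ProperSpace K]

/-- Among four vectors of a step of the filtration defined by an anisotropic cubic form, some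
primitive combination lies in the next step. -/
theorem exists_primitive_combination (hB : ∀ x, cubicForm B x = 0 → x = 0) {c : K} (hc : c ≠ 0)
    (x : Fin 4 → V) (hx : ∀ i, ‖cubicForm B (x i)‖ ≤ ‖c‖) :
    ∃ a : Fin 4 → K, (∀ i, ‖a i‖ ≤ 1) ∧ (∃ i, ‖a i‖ = 1) ∧
      ‖cubicForm B (∑ i, a i • x i)‖ < ‖c‖ := by
  have hc' : 0 < ‖c‖ := norm_pos_iff.2 hc
  obtain ⟨a, ha, ha1, hlt⟩ := exists_primitive_zero_mod_maximalIdeal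
    (fun i j k => c⁻¹ * cubicCoeff B x i j k) fun i j k => by
      rw [norm_mul, norm_inv, inv_mul_le_iff₀ hc', mul_one]
      exact norm_cubicCoeff_le hB hx i j k
  refine ⟨a, ha, ha1, ?_⟩
  simp only [mul_assoc c⁻¹, ← Finset.mul_sum, ← cubicForm_sum_smul] at hlt
  rwa [norm_mul, norm_inv, inv_mul_lt_iff₀ hc', mul_one] at hlt

/-- Each step of the filtration defined by an anisotropic cubic form is generated modulo the next
one by at most three vectors. -/
theorem exists_finrank_le_three (hB : ∀ x, cubicForm B x = 0 → x = 0) {c : K} (hc : c ≠ 0) :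
    ∃ W : Submodule K V, FiniteDimensional K W ∧ Module.finrank K W ≤ 3 ∧
      ∀ y, ‖cubicForm B y‖ ≤ ‖c‖ → ∃ w ∈ W, ‖cubicForm B (y - w)‖ < ‖c‖ := by
  let Indep : ℕ → Prop := fun n => ∃ x : Fin n → V, (∀ i, ‖cubicForm B (x i)‖ ≤ ‖c‖) ∧
    ∀ a : Fin n → K, (∀ i, ‖a i‖ ≤ 1) → ‖cubicForm B (∑ i, a i • x i)‖ < ‖c‖ → ∀ i, ‖a i‖ < 1
  have h0 : Indep 0 := ⟨Fin.elim0, fun i => i.elim0, fun _ _ _ i => i.elim0⟩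
  have h4 : ¬ Indep 4 := by
    rintro ⟨x, hx, h⟩
    obtain ⟨a, ha, ⟨i, hi⟩, hlt⟩ := exists_primitive_combination hB hc x hx
    exact (h a ha hlt i).ne hi
  obtain ⟨n, hn, ⟨x, hx, hxi⟩, hn1⟩ : ∃ n ≤ 3, Indep n ∧ ¬ Indep (n + 1) := by
    by_contra! h
    exact h4 (h 3 (by lia) (h 2 (by lia) (h 1 (by lia) (h 0 (by lia) h0))))
  refine ⟨Submodule.span K (Set.range x), FiniteDimensional.span_of_finite K (Set.finite_range x),
    (finrank_range_le_card x).trans (by simpa using hn), fun y hy => ?_⟩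
  have hdep : ∃ a : Fin (n + 1) → K, (∀ i, ‖a i‖ ≤ 1) ∧
      ‖cubicForm B (a 0 • y + ∑ i : Fin n, a i.succ • x i)‖ < ‖c‖ ∧ ∃ i, 1 ≤ ‖a i‖ := by
    by_contra! h
    refine hn1 ⟨Fin.cons y x, Fin.cases hy hx, fun a ha hlt => h a ha ?_⟩
    simpa [Fin.sum_univ_succ] using hlt
  obtain ⟨a, ha, hlt, i, hi⟩ := hdep
  have ha0 : ‖a 0‖ = 1 := by
    refine le_antisymm (ha 0) (not_lt.1 fun h0lt => ?_)
    have hy' : ‖cubicForm B (-(a 0 • y))‖ < ‖c‖ := by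
      rw [cubicForm_neg, norm_neg, cubicForm_smul, norm_mul, norm_pow]
      calc ‖a 0‖ ^ 3 * ‖cubicForm B y‖ ≤ ‖a 0‖ ^ 3 * ‖c‖ := by gcongr
        _ < 1 * ‖c‖ := by
          gcongr
          exact pow_lt_one₀ (norm_nonneg _) h0lt three_ne_zero
        _ = ‖c‖ := one_mul _
    have hsum : ‖cubicForm B (∑ i : Fin n, a i.succ • x i)‖ < ‖c‖ := by
      have := (norm_cubicForm_add_le hB (-(a 0 • y)) _).trans_lt (max_lt hy' hlt)
      rwa [neg_add_cancel_left] at this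
    have hsucc := hxi (fun i => a i.succ) (fun i => ha _) hsum
    exact hi.not_gt (Fin.cases h0lt hsucc i)
  have ha0' : a 0 ≠ 0 := norm_pos_iff.1 (ha0 ▸ one_pos)
  refine ⟨-((a 0)⁻¹ • ∑ i : Fin n, a i.succ • x i), ?_, ?_⟩
  · exact neg_mem (Submodule.smul_mem _ _ (sum_mem fun i _ =>
      Submodule.smul_mem _ _ (Submodule.subset_span ⟨i, rfl⟩)))
  · have : y - -((a 0)⁻¹ • ∑ i : Fin n, a i.succ • x i) =
        (a 0)⁻¹ • (a 0 • y + ∑ i : Fin n, a i.succ • x i) := by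
      rw [smul_add, inv_smul_smul₀ ha0', sub_neg_eq_add]
    rw [this, cubicForm_smul, norm_mul, norm_pow, norm_inv, ha0]
    simpa using hlt

/-- Modulo multiplication by a uniformizer, the unit ball of an anisotropic cubic form is generated
by at most nine vectors. -/
theorem exists_finrank_le_nine (hB : ∀ x, cubicForm B x = 0 → x = 0) {ϖ : K} (hϖ : ϖ ≠ 0)
    (hmax : ∀ x : K, ‖x‖ < 1 → ‖x‖ ≤ ‖ϖ‖) :
    ∃ W : Submodule K V, FiniteDimensional K W ∧ Module.finrank K W ≤ 9 ∧
      ∀ y, ‖cubicForm B y‖ ≤ 1 → ∃ w ∈ W, ∃ z, ‖cubicForm B z‖ ≤ 1 ∧ y = w + ϖ • z := by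
  have step : ∀ c : K, c ≠ 0 → ∃ W : Submodule K V, FiniteDimensional K W ∧
      Module.finrank K W ≤ 3 ∧
      ∀ y, ‖cubicForm B y‖ ≤ ‖c‖ → ∃ w ∈ W, ‖cubicForm B (y - w)‖ ≤ ‖ϖ * c‖ := by
    intro c hc
    obtain ⟨W, hfin, hrank, hW⟩ := exists_finrank_le_three hB hc
    refine ⟨W, hfin, hrank, fun y hy => ?_⟩
    obtain ⟨w, hw, hlt⟩ := hW y hy
    have hc' : 0 < ‖c‖ := norm_pos_iff.2 hc
    refine ⟨w, hw, ?_⟩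
    have := hmax (cubicForm B (y - w) / c) (by rwa [norm_div, div_lt_one hc'])
    rwa [norm_div, div_le_iff₀ hc', ← norm_mul] at this
  obtain ⟨W₁, hf₁, hr₁, hW₁⟩ := step 1 one_ne_zero
  obtain ⟨W₂, hf₂, hr₂, hW₂⟩ := step (ϖ * 1) (by simpa using hϖ)
  obtain ⟨W₃, hf₃, hr₃, hW₃⟩ := step (ϖ * (ϖ * 1)) (by simpa using hϖ)
  refine ⟨W₁ ⊔ W₂ ⊔ W₃, inferInstance, ?_, fun y hy => ?_⟩
  · have h₁ := Submodule.finrank_add_le_finrank_add_finrank W₁ W₂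
    have h₂ := Submodule.finrank_add_le_finrank_add_finrank (W₁ ⊔ W₂) W₃
    lia
  · obtain ⟨w₁, hw₁, h₁⟩ := hW₁ y (by simpa using hy)
    obtain ⟨w₂, hw₂, h₂⟩ := hW₂ _ h₁
    obtain ⟨w₃, hw₃, h₃⟩ := hW₃ _ h₂
    refine ⟨w₁ + w₂ + w₃, Submodule.add_mem_sup (Submodule.add_mem_sup hw₁ hw₂) hw₃,
      ϖ⁻¹ • (y - w₁ - w₂ - w₃), ?_, ?_⟩
    · have : 0 < ‖ϖ‖ := norm_pos_iff.2 hϖ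
      rw [cubicForm_smul, norm_mul, norm_pow, norm_inv, inv_pow, inv_mul_le_iff₀ (by positivity)]
      calc _ ≤ _ := h₃
        _ = _ := by simp only [norm_mul, norm_one]; ring
    · rw [smul_inv_smul₀ hϖ]
      abel

end AnisotropicCubic

/-- A bound for the coordinates in terms of an anisotropic cubic form. -/
theorem exists_norm_le_of_norm_cubicForm_le_one {K : Type*} [NontriviallyNormedField K]
    [ProperSpace K] {m : ℕ} {B : (Fin m → K) →ₗ[K] (Fin m → K) →ₗ[K] (Fin m → K) →ₗ[K] K}
    (hcont : Continuous (cubicForm B)) (hB : ∀ x, cubicForm B x = 0 → x = 0) :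
    ∃ C : ℝ, ∀ x, ‖cubicForm B x‖ ≤ 1 → ‖x‖ ≤ C := by
  obtain ⟨δ, hδ, hmin⟩ := (isCompact_sphere (0 : Fin m → K) 1).exists_forall_le'
    (f := fun u => ‖cubicForm B u‖) hcont.norm.continuousOn (a := 0) fun u hu =>
      norm_pos_iff.2 fun h => by simp [hB u h] at hu
  refine ⟨max 1 δ⁻¹, fun x hx => ?_⟩
  rcases le_total ‖x‖ 1 with hx1 | hx1
  · exact hx1.trans (le_max_left _ _)
  have hx0 : 0 < ‖x‖ := one_pos.trans_le hx1
  obtain ⟨i, hi⟩ : ∃ i, ‖x i‖ = ‖x‖ := by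
    have hne : Nonempty (Fin m) := by
      by_contra h
      rw [not_nonempty_iff] at h
      simp [Subsingleton.elim x 0] at hx0
    obtain ⟨i, hi⟩ := Finite.exists_max fun i => ‖x i‖
    exact ⟨i, le_antisymm (norm_le_pi_norm x i) ((pi_norm_le_iff_of_nonneg (norm_nonneg _)).2 hi)⟩
  have hxi : x i ≠ 0 := norm_pos_iff.1 (hi ▸ hx0)
  have hu := hmin ((x i)⁻¹ • x) (by simp [norm_smul, hi, hx0.ne'])
  rw [cubicForm_smul, norm_mul, norm_pow, norm_inv, hi, inv_pow, le_inv_mul_iff₀ (by positivity)]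
    at hu
  refine le_trans ?_ (le_max_right _ _)
  rw [← one_div, le_div_iff₀ hδ]
  calc ‖x‖ * δ ≤ ‖x‖ ^ 3 * δ := by
        gcongr
        exact le_self_pow₀ hx1 three_ne_zero
    _ ≤ 1 := hu.trans hx

theorem MvPolynomial.IsHomogeneous.exists_cubicForm_eq_eval {K : Type*} [Field K] {m : ℕ}
    {f : MvPolynomial (Fin m) K} (hf : f.IsHomogeneous 3) :
    ∃ B : (Fin m → K) →ₗ[K] (Fin m → K) →ₗ[K] (Fin m → K) →ₗ[K] K,
      ∀ x, cubicForm B x = MvPolynomial.eval x f := by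
  have hmon : ∀ d ∈ f.support,
      ∃ B : (Fin m → K) →ₗ[K] (Fin m → K) →ₗ[K] (Fin m → K) →ₗ[K] K,
        ∀ x, cubicForm B x = f.coeff d * ∏ i, x i ^ d i := by
    intro d hd
    have hcard : Multiset.card (Finsupp.toMultiset d) = 3 := by
      rw [Finsupp.card_toMultiset]
      simpa [Finsupp.weight_apply, Function.id_def] using hf (MvPolynomial.mem_support_iff.1 hd)
    obtain ⟨i, j, k, hijk⟩ := Multiset.card_eq_three.1 hcard
    refine ⟨(LinearMap.proj i).smulRight ((LinearMap.proj j).smulRight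
      (f.coeff d • LinearMap.proj k)), fun x => ?_⟩
    have hprod : ∏ i, x i ^ d i = x i * x j * x k := by
      have h := congrArg (fun s : Multiset (Fin m) => (s.map x).prod) hijk
      rw [Finsupp.toMultiset_map, Finsupp.prod_toMultiset,
        Finsupp.prod_mapDomain_index (fun _ => pow_zero _) (fun _ _ _ => pow_add _ _ _),
        Finsupp.prod_fintype _ _ (fun _ => pow_zero _)] at h
      simpa [mul_assoc] using h
    rw [hprod]
    simp only [cubicForm, LinearMap.smulRight_apply, LinearMap.smul_apply, LinearMap.proj_apply,
      smul_eq_mul]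
    ring
  choose! B hB using hmon
  refine ⟨∑ d ∈ f.support, B d, fun x => ?_⟩
  rw [MvPolynomial.eval_eq', ← Finset.sum_congr rfl fun d hd => hB d hd x]
  simp [cubicForm, LinearMap.sum_apply]

/-- A cubic form in at least ten variables over a locally compact nonarchimedean field is
isotropic. -/
theorem exists_cubicForm_eq_zero {K : Type*} [NontriviallyNormedField K] [IsUltrametricDist K]
    [ProperSpace K] {m : ℕ} (hm : 10 ≤ m)
    (B : (Fin m → K) →ₗ[K] (Fin m → K) →ₗ[K] (Fin m → K) →ₗ[K] K)
    (hcont : Continuous (cubicForm B)) : ∃ x, x ≠ 0 ∧ cubicForm B x = 0 := by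
  by_contra! hB
  replace hB : ∀ x, cubicForm B x = 0 → x = 0 := fun x => not_imp_not.1 (hB x)
  obtain ⟨ϖ, hϖ, hϖ1, hmax⟩ := exists_uniformizer_of_properSpace K
  obtain ⟨W, hfin, hrank, hW⟩ := exists_finrank_le_nine hB hϖ hmax
  obtain ⟨C, hC⟩ := exists_norm_le_of_norm_cubicForm_le_one hcont hB
  have hlt : W < ⊤ := lt_top_iff_ne_top.2 fun h => by
    rw [h, finrank_top, Module.finrank_fin_fun] at hrank
    lia
  obtain ⟨l, hl0, hl⟩ := W.exists_le_ker_of_lt_top hlt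
  let L : (Fin m → K) →L[K] K := l.toContinuousLinearMap
  have hbound : ∀ n : ℕ, ∀ y, ‖cubicForm B y‖ ≤ 1 → ‖l y‖ ≤ ‖ϖ‖ ^ n * (‖L‖ * C) := by
    intro n
    induction n with
    | zero =>
      intro y hy
      rw [pow_zero, one_mul]
      exact (L.le_opNorm y).trans (by gcongr; exact hC y hy)
    | succ n ih =>
      intro y hy
      obtain ⟨w, hw, z, hz, rfl⟩ := hW y hy
      rw [map_add, LinearMap.mem_ker.1 (hl hw), zero_add, map_smul, norm_smul, pow_succ',
        mul_assoc]
      gcongr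
      exact ih z hz
  have htend := tendsto_pow_atTop_nhds_zero_of_lt_one (norm_nonneg ϖ) hϖ1
  have hzero : ∀ y, ‖cubicForm B y‖ ≤ 1 → l y = 0 := fun y hy => by
    have := ge_of_tendsto' (htend.mul_const (‖L‖ * C)) fun n => hbound n y hy
    rwa [zero_mul, norm_le_zero_iff] at this
  refine hl0 (LinearMap.ext fun y => ?_)
  have htend' : Filter.Tendsto (fun n : ℕ => (‖ϖ‖ ^ n) ^ 3 * ‖cubicForm B y‖) Filter.atTop
      (nhds 0) := by
    simpa using (htend.pow 3).mul_const ‖cubicForm B y‖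
  obtain ⟨n, hn⟩ := (htend'.eventually_le_const one_pos).exists
  have := hzero (ϖ ^ n • y) (by rwa [cubicForm_smul, norm_mul, norm_pow, norm_pow])
  rw [map_smul, smul_eq_mul, mul_eq_zero] at this
  exact this.resolve_left (pow_ne_zero n hϖ)

/-- **Demjanov–Lewis**. Every cubic form in at least `10` variables over a `p`-adic field
(a finite-dimensional field extension of `ℚ_p`) has a nontrivial zero. -/
theorem demjanov_lewis_cubic_forms_padic (p : ℕ) [Fact p.Prime]
    (K : Type*) [Field K] [Algebra ℚ_[p] K] [FiniteDimensional ℚ_[p] K]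
    (m : ℕ) (hm : 10 ≤ m)
    (f : MvPolynomial (Fin m) K) (hf : f.IsHomogeneous 3) :
    ∃ x : Fin m → K, x ≠ 0 ∧ MvPolynomial.eval x f = 0 := by
  obtain ⟨B, hB⟩ := hf.exists_cubicForm_eq_eval
  let := spectralNorm.nontriviallyNormedField ℚ_[p] K
  let : NormedAlgebra ℚ_[p] K := spectralNorm.normedAlgebra ℚ_[p] K
  have : IsUltrametricDist K :=
    IsUltrametricDist.isUltrametricDist_of_isNonarchimedean_norm
      (isNonarchimedean_spectralNorm (K := ℚ_[p]) (L := K))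
  have : ProperSpace K := FiniteDimensional.proper ℚ_[p] K
  have hcont : Continuous (cubicForm B) := by
    rw [funext hB]
    exact f.continuous_eval
  simpa only [hB] using exists_cubicForm_eq_zero hm B hcont
end

section
/- For every natural number d ≥ 1 there exists a natural number N such that for every prime number p with p ≥ N the following holds: for every natural number n with n ≥ d^2, every homogeneous polynomial of degree d in n+1 variables with coefficients in ℚ_p has a nontrivial zero, i.e. there exists x ∈ ℚ_p^{n+1} with x ≠ 0 and f(x) = 0. -/
section ValuedFields

open Polynomial Filter
open scoped WithZero

/-- A henselian valued field `K` with value group `Γ₀` and an angular component map to `k`. -/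
structure AngularField (K k Γ₀ : Type*) [Field K] [Field k]
    [LinearOrderedCommGroupWithZero Γ₀] where
  /-- the valuation -/
  v : Valuation K Γ₀
  /-- the angular component -/
  ac : K →*₀ k
  ac_add : ∀ x y, v x ≤ 1 → v y ≤ 1 →
    (if v (x + y) = 1 then ac (x + y) else 0) =
      (if v x = 1 then ac x else 0) + (if v y = 1 then ac y else 0)
  exists_lift : ∀ γ u, γ ≠ 0 → u ≠ 0 → ∃ x, v x = γ ∧ ac x = u
  hensel : ∀ P : K[X], (∀ i, v (P.coeff i) ≤ 1) → v (P.eval 1) < 1 →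
    v (P.derivative.eval 1) = 1 → ∃ z, P.eval z = 0 ∧ v (z - 1) < 1

namespace AngularField

section Single

variable {K k Γ₀ : Type*} [Field K] [Field k] [LinearOrderedCommGroupWithZero Γ₀]
variable (D : AngularField K k Γ₀)

/-- The coefficient of `x` at level `γ`, meaningful for `v x ≤ γ`. -/
def lead (γ : Γ₀) (x : K) : k := if D.v x = γ then D.ac x else 0

variable {D}

lemma lead_self (x : K) : D.lead (D.v x) x = D.ac x := if_pos rfl

lemma lead_ne_zero {γ : Γ₀} (hγ : γ ≠ 0) {x : K} : D.lead γ x ≠ 0 ↔ D.v x = γ := by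
  unfold lead
  split_ifs with h
  · have : x ≠ 0 := by rintro rfl; exact hγ (by simpa using h.symm)
    simpa [h] using this
  · simpa using h

lemma lead_mul {γ : Γ₀} (hγ : γ ≠ 0) (x t : K) (ht : D.v t = γ) (ht' : D.ac t = 1) :
    D.lead γ x = D.lead 1 (x / t) := by
  unfold lead
  simp [ht, ht', div_eq_one_iff_eq hγ]

lemma lead_add {γ : Γ₀} (hγ : γ ≠ 0) {x y : K} (hx : D.v x ≤ γ) (hy : D.v y ≤ γ) :
    D.lead γ (x + y) = D.lead γ x + D.lead γ y := by
  obtain ⟨t, ht, ht'⟩ := D.exists_lift γ 1 hγ one_ne_zero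
  rw [lead_mul hγ _ t ht ht', lead_mul hγ x t ht ht', lead_mul hγ y t ht ht', add_div]
  apply D.ac_add <;> rw [map_div₀, ht] <;> exact div_le_one_of_le₀ ‹_› zero_le

lemma lead_sum {ι : Type*} {γ : Γ₀} (hγ : γ ≠ 0) (s : Finset ι) (f : ι → K)
    (hf : ∀ i ∈ s, D.v (f i) ≤ γ) : D.lead γ (∑ i ∈ s, f i) = ∑ i ∈ s, D.lead γ (f i) := by
  classical
  induction s using Finset.induction_on with
  | empty => simp [lead]
  | insert a s ha ih =>
    rw [Finset.sum_insert ha, Finset.sum_insert ha,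
      lead_add hγ (hf _ (Finset.mem_insert_self _ _))
        (D.v.map_sum_le fun i hi => hf i (Finset.mem_insert_of_mem hi)),
      ih fun i hi => hf i (Finset.mem_insert_of_mem hi)]

lemma lead_one_natCast (n : ℕ) : D.lead 1 (n : K) = n := by
  induction n with
  | zero => simp [lead]
  | succ n ih =>
    have h1 : D.lead 1 (1 : K) = 1 := by simp [lead]
    have hn : ∀ n : ℕ, D.v (n : K) ≤ 1 := fun n => by
      induction n with
      | zero => simp
      | succ n ih => push_cast; exact D.v.map_add_le ih (by simp)
    push_cast
    rw [lead_add one_ne_zero (hn n) (by simp), ih, h1]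

lemma v_natCast [CharZero k] {n : ℕ} (hn : n ≠ 0) : D.v (n : K) = 1 := by
  apply (lead_ne_zero (D := D) one_ne_zero).1
  rw [lead_one_natCast]
  exact_mod_cast hn

lemma ac_eq_one_of_sub {z : K} (hz : D.v (z - 1) < 1) : D.v z = 1 ∧ D.ac z = 1 := by
  have h : D.lead 1 z = 1 := by
    have : D.lead 1 (z - 1 + 1) = D.lead 1 (z - 1) + D.lead 1 1 :=
      lead_add one_ne_zero hz.le (by simp)
    simpa [lead, hz.ne] using this
  have h1 : D.v z = 1 := (lead_ne_zero one_ne_zero).1 (by rw [h]; exact one_ne_zero)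
  refine ⟨h1, ?_⟩
  rwa [← h1, lead_self] at h

lemma eval_eq_sum_taylor (P : K[X]) (c h : K) {n : ℕ} (hn : P.natDegree < n) :
    P.eval (c + h) = ∑ i ∈ Finset.range n, (taylor c P).coeff i * h ^ i := by
  rw [← eval_eq_sum_range' (by rwa [natDegree_taylor])]
  simp [taylor_eval, add_comm]

lemma taylor_coeff_derivative (P : K[X]) (c : K) (i : ℕ) :
    (taylor c (derivative P)).coeff i = (taylor c P).coeff (i + 1) * ((i + 1 : ℕ) : K) := by
  have : taylor c (derivative P) = derivative (taylor c P) := by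
    simp [taylor_apply, derivative_comp]
  rw [this, coeff_derivative]
  push_cast
  rfl

/-- Hensel's lemma on a ball of arbitrary radius. -/
lemma hensel_ball (P : K[X]) {c h a : K} (ha : a ≠ 0)
    (hc : ∀ i, D.v ((taylor c P).coeff i * h ^ i) ≤ D.v a)
    (h0 : D.v (P.eval (c + h)) < D.v a)
    (h1 : D.v (h * P.derivative.eval (c + h)) = D.v a) :
    ∃ z, P.eval (c + h * z) = 0 ∧ D.v (z - 1) < 1 := by
  have hva : D.v a ≠ 0 := by simpa using ha
  have hev : ∀ z, (C a⁻¹ * (taylor c P).comp (C h * X)).eval z = a⁻¹ * P.eval (c + h * z) := by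
    intro z; simp [taylor_eval, add_comm]
  have hcoeff : ∀ i, D.v ((C a⁻¹ * (taylor c P).comp (C h * X)).coeff i) ≤ 1 := fun i => by
    rw [coeff_C_mul, comp_C_mul_X_coeff, map_mul, map_inv₀, mul_comm, ← div_eq_mul_inv]
    exact div_le_one_of_le₀ (hc i) zero_le
  have hroot : D.v ((C a⁻¹ * (taylor c P).comp (C h * X)).eval 1) < 1 := by
    rw [hev, mul_one, map_mul, map_inv₀, mul_comm, ← div_eq_mul_inv]
    exact (div_lt_one₀ (zero_lt_iff.2 hva)).2 h0
  have hder : D.v ((derivative (C a⁻¹ * (taylor c P).comp (C h * X))).eval 1) = 1 := by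
    have : (derivative (C a⁻¹ * (taylor c P).comp (C h * X))).eval 1
        = a⁻¹ * (h * P.derivative.eval (c + h)) := by
      simp [taylor_apply, derivative_comp, add_comm]
    rw [this, map_mul, h1, map_inv₀, inv_mul_cancel₀ hva]
  obtain ⟨z, hz, hz1⟩ := D.hensel _ hcoeff hroot hder
  refine ⟨z, ?_, hz1⟩
  rw [hev] at hz
  simpa [ha] using hz

/-- If there is cancellation in the Taylor expansion then a term of positive degree is dominant. -/
lemma exists_dominant (P : K[X]) {c h : K} {i₀ : ℕ}
    (hlt : D.v (P.eval (c + h)) < D.v ((taylor c P).coeff i₀ * h ^ i₀)) :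
    ∃ i, (∀ j, D.v ((taylor c P).coeff j * h ^ j) ≤
        D.v ((taylor c P).coeff (i + 1) * h ^ (i + 1))) ∧
      D.v (P.eval (c + h)) < D.v ((taylor c P).coeff (i + 1) * h ^ (i + 1)) := by
  set g : ℕ → K := fun i => (taylor c P).coeff i * h ^ i with hg
  have hg0 : ∀ i, P.natDegree < i → g i = 0 := fun i hi => by
    simp [hg, coeff_eq_zero_of_natDegree_lt (p := taylor c P) (by rwa [natDegree_taylor])]
  obtain ⟨m, hm, hmax⟩ := Finset.exists_max_image (Finset.range (P.natDegree + 1))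
    (fun i => D.v (g i)) ⟨0, by simp⟩
  replace hmax : ∀ j, D.v (g j) ≤ D.v (g m) := fun j => by
    by_cases hj : j < P.natDegree + 1
    · exact hmax j (by simpa using hj)
    · simp [hg0 j (by omega)]
  have hltm := hlt.trans_le (hmax i₀)
  by_cases hex : ∃ i, D.v (g (i + 1)) = D.v (g m)
  · obtain ⟨i, hi⟩ := hex
    exact ⟨i, fun j => (hmax j).trans hi.ge, hltm.trans_eq hi.symm⟩
  · exfalso
    push Not at hex
    obtain rfl : m = 0 := by
      rcases m with _ | m
      · rfl
      · exact absurd rfl (hex m)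
    have hγ : D.v (g 0) ≠ 0 := (zero_le.trans_lt hltm).ne'
    have h1 : D.lead (D.v (g 0)) (P.eval (c + h)) = D.lead (D.v (g 0)) (g 0) := by
      rw [eval_eq_sum_taylor P c h (Nat.lt_succ_self _), lead_sum hγ _ _ fun i _ => hmax i,
        Finset.sum_eq_single 0]
      · intro i _ hi
        obtain ⟨i, rfl⟩ := Nat.exists_eq_succ_of_ne_zero hi
        exact if_neg (hex i)
      · simp
    have h2 : D.v (P.eval (c + h)) = D.v (g 0) := by
      rw [← lead_ne_zero hγ, h1, lead_ne_zero hγ]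
    exact hltm.ne h2

lemma v_mul_derivative_eval [CharZero k] (P : K[X]) {c h : K} {m : ℕ}
    (hmax : ∀ j, D.v ((taylor c P).coeff j * h ^ j) ≤
      D.v ((taylor c P).coeff (m + 1) * h ^ (m + 1)))
    (hd : D.v ((taylor c (derivative P)).coeff m * h ^ m) ≤ D.v (P.derivative.eval (c + h))) :
    D.v (h * P.derivative.eval (c + h)) = D.v ((taylor c P).coeff (m + 1) * h ^ (m + 1)) := by
  apply le_antisymm
  · have : h * P.derivative.eval (c + h) = ∑ i ∈ Finset.range (P.derivative.natDegree + 1),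
        (i + 1 : ℕ) * ((taylor c P).coeff (i + 1) * h ^ (i + 1)) := by
      rw [eval_eq_sum_taylor P.derivative c h (Nat.lt_succ_self _), Finset.mul_sum]
      refine Finset.sum_congr rfl fun i _ => ?_
      rw [taylor_coeff_derivative]; ring
    rw [this]
    refine D.v.map_sum_le fun i _ => ?_
    rw [map_mul, v_natCast (Nat.succ_ne_zero i), one_mul]
    exact hmax (i + 1)
  · rw [taylor_coeff_derivative, map_mul, map_mul, v_natCast (Nat.succ_ne_zero m), mul_one,
      map_pow] at hd
    rw [map_mul, map_mul, map_pow, pow_succ', mul_left_comm]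
    gcongr

/-- Around a center that is at least as close to `c + h` as any root of `P` and of its derivatives,
there is no cancellation in the Taylor expansion of `P`. -/
lemma no_cancellation [CharZero k] (P : K[X]) {c h : K} (hh : h ≠ 0)
    (hr : ∀ j r, derivative^[j] P ≠ 0 → (derivative^[j] P).eval r = 0 → D.v h ≤ D.v (c + h - r))
    (i : ℕ) : D.v ((taylor c P).coeff i * h ^ i) ≤ D.v (P.eval (c + h)) := by
  induction hn : P.natDegree using Nat.strong_induction_on generalizing P i with
  | _ n ih =>
  by_contra! hlt
  obtain ⟨m, hmax, hltm⟩ := exists_dominant P hlt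
  have hP : P ≠ 0 := by rintro rfl; simp at hlt
  set a := (taylor c P).coeff (m + 1) * h ^ (m + 1) with ha
  have ha0 : a ≠ 0 := fun h0 => by simp [h0] at hltm
  have hpos : 0 < P.natDegree := by
    by_contra h0
    refine ha0 ?_
    rw [ha, coeff_eq_zero_of_natDegree_lt (p := taylor c P) (by rw [natDegree_taylor]; omega),
      zero_mul]
  have hd := ih _ (hn ▸ natDegree_derivative_lt hpos.ne') (derivative P)
    (fun j r h1 h2 => hr (j + 1) r h1 h2) m rfl
  have h1 := v_mul_derivative_eval P hmax hd
  obtain ⟨z, hz, hz1⟩ := hensel_ball P ha0 hmax hltm h1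
  have := hr 0 _ hP hz
  rw [show c + h - (c + h * z) = - (h * (z - 1)) by ring, Valuation.map_neg, map_mul] at this
  refine this.not_gt (mul_lt_of_lt_one_right (zero_lt_iff.2 (by simpa using hh)) hz1)

end Single

section Pair

variable {K L k Γ₀ : Type} [Field K] [Field L] [Field k] [LinearOrderedCommGroupWithZero Γ₀]

/-- `x` and `y` have the same leading term. -/
def SameLead (D : AngularField K k Γ₀) (E : AngularField L k Γ₀) (x : K) (y : L) : Prop :=
  D.v x = E.v y ∧ D.ac x = E.ac y

variable {D : AngularField K k Γ₀} {E : AngularField L k Γ₀}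

lemma SameLead.symm {x : K} {y : L} (h : SameLead D E x y) : SameLead E D y x :=
  ⟨h.1.symm, h.2.symm⟩

lemma SameLead.mul {x x' : K} {y y' : L} (h : SameLead D E x y) (h' : SameLead D E x' y') :
    SameLead D E (x * x') (y * y') :=
  ⟨by rw [map_mul, map_mul, h.1, h'.1], by rw [map_mul, map_mul, h.2, h'.2]⟩

lemma SameLead.pow {x : K} {y : L} (h : SameLead D E x y) (n : ℕ) :
    SameLead D E (x ^ n) (y ^ n) :=
  ⟨by rw [map_pow, map_pow, h.1], by rw [map_pow, map_pow, h.2]⟩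

lemma SameLead.of_mul {x x' : K} {y y' : L} (h : SameLead D E x y) (hx : x ≠ 0)
    (h' : SameLead D E (x * x') (y * y')) : SameLead D E x' y' := by
  have h1 : E.v y ≠ 0 := by rw [← h.1]; simpa using hx
  have h2 : E.ac y ≠ 0 := by rw [← h.2]; simpa using hx
  obtain ⟨h3, h4⟩ := h'
  rw [map_mul, map_mul, h.1] at h3
  rw [map_mul, map_mul, h.2] at h4
  exact ⟨mul_left_cancel₀ h1 h3, mul_left_cancel₀ h2 h4⟩

lemma SameLead.eq_zero_iff {x : K} {y : L} (h : SameLead D E x y) : x = 0 ↔ y = 0 := by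
  rw [← D.v.zero_iff, h.1, E.v.zero_iff]

lemma SameLead.lead {x : K} {y : L} (h : SameLead D E x y) (γ : Γ₀) :
    D.lead γ x = E.lead γ y := by
  simp only [AngularField.lead, h.1, h.2]

lemma sameLead_zero : SameLead D E 0 0 := by simp [SameLead]

/-- Countably many conditions on leading terms of polynomials in one variable can be satisfied
simultaneously as soon as any finitely many of them can. -/
def Saturated (E : AngularField L k Γ₀) : Prop :=
  ∀ (P : ℕ → L[X]) (γ : ℕ → Γ₀) (u : ℕ → k),
    (∀ n, ∃ y, ∀ j < n, γ j = E.v ((P j).eval y) ∧ u j = E.ac ((P j).eval y)) →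
      ∃ y, ∀ j, γ j = E.v ((P j).eval y) ∧ u j = E.ac ((P j).eval y)

variable (D E) in
/-- A partial isomorphism between countably generated subrings of `K` and `L` preserving leading
terms. -/
structure PartialIso where
  /-- the countable ring parametrizing both subrings -/
  R : Type
  [ring : CommRing R]
  [countable : Countable R]
  /-- the map to the first field -/
  φ : R →+* K
  /-- the map to the second field -/
  ψ : R →+* L
  compat : ∀ r, SameLead D E (φ r) (ψ r)

namespace PartialIso

attribute [instance] PartialIso.ring PartialIso.countable

/-- `B` extends `A`. -/
def Extends (B A : PartialIso D E) : Prop :=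
  ∃ i : A.R →+* B.R, B.φ.comp i = A.φ ∧ B.ψ.comp i = A.ψ

lemma Extends.refl (A : PartialIso D E) : A.Extends A := ⟨RingHom.id _, rfl, rfl⟩

lemma Extends.trans {A B C : PartialIso D E} (h : C.Extends B) (h' : B.Extends A) :
    C.Extends A := by
  obtain ⟨i, hiφ, hiψ⟩ := h
  obtain ⟨j, hjφ, hjψ⟩ := h'
  exact ⟨i.comp j, by rw [← RingHom.comp_assoc, hiφ, hjφ], by rw [← RingHom.comp_assoc, hiψ, hjψ]⟩

/-- The partial isomorphism in the opposite direction. -/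
def symm (A : PartialIso D E) : PartialIso E D where
  R := A.R
  φ := A.ψ
  ψ := A.φ
  compat r := (A.compat r).symm

/-- `A` extends to a partial isomorphism sending `x` to `y`. -/
def CanMap (A : PartialIso D E) (x : K) (y : L) : Prop :=
  ∀ F : A.R[X], SameLead D E ((F.map A.φ).eval x) ((F.map A.ψ).eval y)

lemma countable_polynomial (R : Type*) [CommRing R] [Countable R] : Countable R[X] := by
  rw [← Cardinal.mk_le_aleph0_iff]
  exact cardinalMk_le_max.trans (max_le Cardinal.mk_le_aleph0 le_rfl)

lemma CanMap.exists_extends {A : PartialIso D E} {x : K} {y : L} (h : A.CanMap x y) :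
    ∃ B : PartialIso D E, B.Extends A ∧ x ∈ Set.range B.φ :=
  ⟨{ R := A.R[X]
     countable := countable_polynomial _
     φ := eval₂RingHom A.φ x
     ψ := eval₂RingHom A.ψ y
     compat := fun F => by simpa [eval_map] using h F },
    ⟨C, by ext; simp, by ext; simp⟩, X, by simp⟩

/-- Every extension of `A` can be extended to `x`. -/
def Extendable (A : PartialIso D E) (x : K) : Prop :=
  ∀ B : PartialIso D E, B.Extends A → ∃ y, B.CanMap x y

lemma exists_extends_finset (A : PartialIso D E) (T : Finset K)
    (hT : ∀ z ∈ T, A.Extendable z) :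
    ∃ B : PartialIso D E, B.Extends A ∧ ∀ z ∈ T, z ∈ Set.range B.φ := by
  classical
  induction T using Finset.induction_on with
  | empty => exact ⟨A, .refl A, by simp⟩
  | insert a s ha ih =>
    obtain ⟨B, hB, hs⟩ := ih fun z hz => hT z (Finset.mem_insert_of_mem hz)
    obtain ⟨y, hy⟩ := hT a (Finset.mem_insert_self _ _) B hB
    obtain ⟨C, hC, haC⟩ := hy.exists_extends
    refine ⟨C, hC.trans hB, fun z hz => ?_⟩
    obtain rfl | hz := Finset.mem_insert.1 hz
    · exact haC
    · obtain ⟨r, rfl⟩ := hs z hz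
      obtain ⟨i, hi, -⟩ := hC
      exact ⟨i r, by rw [← hi]; rfl⟩

/-- After a finite extension there is a center at least as close to `x` as any root of the given
polynomials and their derivatives. -/
lemma exists_center (A : PartialIso D E) (S : Finset A.R[X]) (x : K)
    (hS : ∀ G ∈ S, ∀ j z, derivative^[j] (G.map A.φ) ≠ 0 →
      (derivative^[j] (G.map A.φ)).eval z = 0 → A.Extendable z) :
    ∃ B : PartialIso D E, B.Extends A ∧ ∃ c : B.R, ∀ G ∈ S, ∀ j z,
      derivative^[j] (G.map A.φ) ≠ 0 → (derivative^[j] (G.map A.φ)).eval z = 0 →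
        D.v (x - B.φ c) ≤ D.v (x - z) := by
  classical
  let T : Finset K := S.biUnion fun G => (Finset.range (G.natDegree + 1)).biUnion fun j =>
    (derivative^[j] (G.map A.φ)).roots.toFinset
  have hmem : ∀ G ∈ S, ∀ j z, derivative^[j] (G.map A.φ) ≠ 0 →
      (derivative^[j] (G.map A.φ)).eval z = 0 → z ∈ T := by
    intro G hG j z h0 hz
    refine Finset.mem_biUnion.2 ⟨G, hG, Finset.mem_biUnion.2 ⟨j, ?_, ?_⟩⟩
    · by_contra hj
      refine h0 (iterate_derivative_eq_zero (natDegree_map_le.trans_lt ?_))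
      simpa using hj
    · rw [Multiset.mem_toFinset, mem_roots h0]
      exact hz
  obtain ⟨B, hB, hT⟩ := A.exists_extends_finset T fun z hz => by
    obtain ⟨G, hG, hz⟩ := Finset.mem_biUnion.1 hz
    obtain ⟨j, -, hz⟩ := Finset.mem_biUnion.1 hz
    rw [Multiset.mem_toFinset] at hz
    exact hS G hG j z (ne_zero_of_mem_roots hz) (isRoot_of_mem_roots hz)
  obtain ⟨z, hz, hmin⟩ := Finset.exists_min_image (insert 0 T) (fun z => D.v (x - z))
    ⟨0, Finset.mem_insert_self _ _⟩
  have : z ∈ Set.range B.φ := by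
    obtain rfl | hz := Finset.mem_insert.1 hz
    · exact ⟨0, map_zero _⟩
    · exact hT z hz
  obtain ⟨c, rfl⟩ := this
  exact ⟨B, hB, c, fun G hG j z h0 hz0 =>
    hmin z (Finset.mem_insert_of_mem (hmem G hG j z h0 hz0))⟩

lemma canMap_self (A : PartialIso D E) (c : A.R) : A.CanMap (A.φ c) (A.ψ c) := fun F => by
  simpa [eval_map, eval₂_at_apply] using A.compat (F.eval c)

lemma sameLead_term (A : PartialIso D E) (P : A.R[X]) (c : A.R) {h : K} {h' : L}
    (hh : SameLead D E h h') (i : ℕ) :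
    SameLead D E ((taylor (A.φ c) (P.map A.φ)).coeff i * h ^ i)
      ((taylor (A.ψ c) (P.map A.ψ)).coeff i * h' ^ i) := by
  rw [← map_taylor, ← map_taylor, coeff_map, coeff_map]
  exact (A.compat _).mul (hh.pow i)

lemma lead_eval (A : PartialIso D E) (P : A.R[X]) (c : A.R) {h : K} {h' : L}
    (hh : SameLead D E h h') {γ : Γ₀} (hγ : γ ≠ 0)
    (hP : ∀ i, D.v ((taylor (A.φ c) (P.map A.φ)).coeff i * h ^ i) ≤ γ) :
    D.lead γ ((P.map A.φ).eval (A.φ c + h)) = E.lead γ ((P.map A.ψ).eval (A.ψ c + h')) := by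
  rw [eval_eq_sum_taylor _ _ _ (Nat.lt_succ_of_le (natDegree_map_le (f := A.φ))),
    eval_eq_sum_taylor _ _ _ (Nat.lt_succ_of_le (natDegree_map_le (f := A.ψ))),
    lead_sum hγ _ _ fun i _ => hP i,
    lead_sum hγ _ _ fun i _ => (A.sameLead_term P c hh i).1 ▸ hP i]
  exact Finset.sum_congr rfl fun i _ => (A.sameLead_term P c hh i).lead γ

lemma sameLead_eval (A : PartialIso D E) (P : A.R[X]) (c : A.R) {h : K} {h' : L}
    (hh : SameLead D E h h')
    (hP : ∀ i, D.v ((taylor (A.φ c) (P.map A.φ)).coeff i * h ^ i) ≤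
      D.v ((P.map A.φ).eval (A.φ c + h))) :
    SameLead D E ((P.map A.φ).eval (A.φ c + h)) ((P.map A.ψ).eval (A.ψ c + h')) := by
  by_cases hγ : D.v ((P.map A.φ).eval (A.φ c + h)) = 0
  · have h0 : (P.map A.ψ).eval (A.ψ c + h') = 0 := by
      rw [eval_eq_sum_taylor _ _ _ (Nat.lt_succ_self _)]
      refine Finset.sum_eq_zero fun i _ => (A.sameLead_term P c hh i).eq_zero_iff.1 ?_
      simpa only [hγ, le_zero_iff, D.v.zero_iff] using hP i
    rw [h0, D.v.zero_iff.1 hγ]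
    exact sameLead_zero
  · have h1 := A.lead_eval P c hh hγ hP
    have h2 := (lead_ne_zero hγ).1 (h1 ▸ (lead_ne_zero hγ).2 rfl)
    refine ⟨h2.symm, ?_⟩
    rw [lead_self] at h1
    rw [h1, ← h2, lead_self]

lemma exists_sameLead (D : AngularField K k Γ₀) (E : AngularField L k Γ₀) {h : K} (hh : h ≠ 0) :
    ∃ h', SameLead D E h h' := by
  obtain ⟨h', h1, h2⟩ := E.exists_lift (D.v h) (D.ac h) (by simpa using hh) (by simpa using hh)
  exact ⟨h', h1.symm, h2.symm⟩

lemma exists_sameLead_eval [CharZero k] (A : PartialIso D E) (x : K) (c : A.R) (S : Set A.R[X])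
    (hS : ∀ G ∈ S, ∀ j z, derivative^[j] (G.map A.φ) ≠ 0 →
      (derivative^[j] (G.map A.φ)).eval z = 0 → D.v (x - A.φ c) ≤ D.v (x - z)) :
    ∃ y, ∀ G ∈ S, SameLead D E ((G.map A.φ).eval x) ((G.map A.ψ).eval y) := by
  by_cases hx : x = A.φ c
  · subst hx
    exact ⟨A.ψ c, fun G _ => A.canMap_self c G⟩
  obtain ⟨h, rfl⟩ : ∃ h, x = A.φ c + h := ⟨x - A.φ c, by ring⟩
  have hh : h ≠ 0 := by rintro rfl; simp at hx
  obtain ⟨h', hhh⟩ := exists_sameLead D E hh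
  refine ⟨A.ψ c + h', fun G hG => A.sameLead_eval G c hhh ?_⟩
  refine no_cancellation _ hh fun j r h0 hr => ?_
  simpa using hS G hG j r h0 hr

lemma exists_root_sameLead_eval [CharZero k] (A : PartialIso D E) (x : K) (c : A.R)
    (Q : A.R[X]) (hQ : Q.map A.φ ≠ 0) (hQx : (Q.map A.φ).eval x = 0) (S : Set A.R[X])
    (hQS : derivative Q ∈ S)
    (hS : ∀ G ∈ S, ∀ j z, derivative^[j] (G.map A.φ) ≠ 0 →
      (derivative^[j] (G.map A.φ)).eval z = 0 → D.v (x - A.φ c) ≤ D.v (x - z)) :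
    ∃ y, (Q.map A.ψ).eval y = 0 ∧
      ∀ G ∈ S, SameLead D E ((G.map A.φ).eval x) ((G.map A.ψ).eval y) := by
  by_cases hx : x = A.φ c
  · subst hx
    exact ⟨A.ψ c, (A.canMap_self c Q).eq_zero_iff.1 hQx, fun G _ => A.canMap_self c G⟩
  obtain ⟨h, rfl⟩ : ∃ h, x = A.φ c + h := ⟨x - A.φ c, by ring⟩
  have hh : h ≠ 0 := by rintro rfl; simp at hx
  obtain ⟨h', hhh⟩ := exists_sameLead D E hh
  have hnc : ∀ G ∈ S, ∀ i, D.v ((taylor (A.φ c) (G.map A.φ)).coeff i * h ^ i) ≤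
      D.v ((G.map A.φ).eval (A.φ c + h)) := fun G hG =>
    no_cancellation _ hh fun j r h0 hr => by simpa using hS G hG j r h0 hr
  have hnQ := hnc _ hQS
  obtain ⟨i₀, hi₀⟩ : ∃ i, (taylor (A.φ c) (Q.map A.φ)).coeff i ≠ 0 := by
    by_contra! h0
    exact hQ ((taylor_injective (A.φ c)) (by ext i; simpa using h0 i))
  obtain ⟨m, hmax, hlt⟩ := exists_dominant (D := D) (Q.map A.φ) (c := A.φ c) (h := h) (i₀ := i₀) (by
    rw [hQx, map_zero, zero_lt_iff, D.v.ne_zero_iff]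
    exact mul_ne_zero hi₀ (pow_ne_zero _ hh))
  have hterm := A.sameLead_term Q c hhh
  have hder : (derivative Q).map A.φ = derivative (Q.map A.φ) := (derivative_map _ _).symm
  have hder' : (derivative Q).map A.ψ = derivative (Q.map A.ψ) := (derivative_map _ _).symm
  have hD := v_mul_derivative_eval (D := D) (Q.map A.φ) hmax (hder ▸ hnQ m)
  have hγ := (zero_le.trans_lt hlt).ne'
  have hmax' : ∀ j, E.v ((taylor (A.ψ c) (Q.map A.ψ)).coeff j * h' ^ j) ≤
      E.v ((taylor (A.ψ c) (Q.map A.ψ)).coeff (m + 1) * h' ^ (m + 1)) := fun j => by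
    rw [← (hterm j).1, ← (hterm (m + 1)).1]
    exact hmax j
  have ha : (taylor (A.ψ c) (Q.map A.ψ)).coeff (m + 1) * h' ^ (m + 1) ≠ 0 := by
    rw [Ne, ← (hterm (m + 1)).eq_zero_iff, ← D.v.zero_iff]
    exact hγ
  have hlt' : E.v ((Q.map A.ψ).eval (A.ψ c + h')) <
      E.v ((taylor (A.ψ c) (Q.map A.ψ)).coeff (m + 1) * h' ^ (m + 1)) := by
    refine lt_of_le_of_ne ?_ ?_
    · rw [eval_eq_sum_taylor _ _ _ (Nat.lt_succ_self _)]
      exact E.v.map_sum_le fun i _ => hmax' i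
    · rw [← (hterm (m + 1)).1, Ne, ← lead_ne_zero hγ, not_not, ← A.lead_eval Q c hhh hγ hmax, hQx]
      simp [AngularField.lead]
  obtain ⟨z, hz, hz1⟩ := hensel_ball (Q.map A.ψ) ha hmax' hlt' (by
    rw [← hder', ← (hhh.mul (A.sameLead_eval _ c hhh hnQ)).1, hder, hD, (hterm (m + 1)).1])
  obtain ⟨hvz, hacz⟩ := ac_eq_one_of_sub hz1
  have hhz : SameLead D E h (h' * z) :=
    ⟨by rw [map_mul, hvz, mul_one, hhh.1], by rw [map_mul, hacz, mul_one, hhh.2]⟩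
  exact ⟨_, hz, fun G hG => A.sameLead_eval G c hhz (hnc G hG)⟩

lemma map_map_of_extends {A B : PartialIso D E} {i : A.R →+* B.R} (h : B.φ.comp i = A.φ)
    (h' : B.ψ.comp i = A.ψ) (F : A.R[X]) :
    (F.map i).map B.φ = F.map A.φ ∧ (F.map i).map B.ψ = F.map A.ψ := by
  rw [Polynomial.map_map, Polynomial.map_map, h, h']
  exact ⟨rfl, rfl⟩

lemma exists_canMap_of_root [CharZero k] (hE : E.Saturated) (d : ℕ) (A : PartialIso D E) (x : K)
    (Q : A.R[X]) (hd : Q.natDegree = d) (hQ : Q.map A.φ ≠ 0) (hQx : (Q.map A.φ).eval x = 0) :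
    ∃ y, A.CanMap x y := by
  classical
  induction d using Nat.strong_induction_on generalizing A x with
  | _ d ih =>
  have hpos : Q.natDegree ≠ 0 := fun h0 => by
    rw [eq_C_of_natDegree_eq_zero h0] at hQ hQx
    simp only [map_C, eval_C] at hQ hQx
    simp [hQx] at hQ
  by_cases hlead : A.φ Q.leadingCoeff = 0
  · have hm : Q.eraseLead.map A.φ = Q.map A.φ := by
      have h := congrArg (Polynomial.map A.φ) (eraseLead_add_C_mul_X_pow Q)
      rwa [Polynomial.map_add, Polynomial.map_mul, map_C, hlead, C_0, zero_mul, add_zero] at h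
    refine ih _ ?_ A x Q.eraseLead rfl (by rwa [hm]) (by rwa [hm])
    have := eraseLead_natDegree_le Q
    omega
  have hext : ∀ G : A.R[X], G.natDegree < d → ∀ j z, derivative^[j] (G.map A.φ) ≠ 0 →
      (derivative^[j] (G.map A.φ)).eval z = 0 → A.Extendable z := by
    rintro G hG j z h0 hz B ⟨i, hi, hi'⟩
    have hm : (derivative^[j] (G.map i)).map B.φ = derivative^[j] (G.map A.φ) := by
      rw [← iterate_derivative_map, (map_map_of_extends hi hi' G).1]
    refine ih _ ?_ B z (derivative^[j] (G.map i)) rfl (by rwa [hm]) (by rwa [hm])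
    exact ((natDegree_iterate_derivative _ _).trans (Nat.sub_le _ _)).trans_lt
      (natDegree_map_le.trans_lt hG)
  have : Countable A.R[X] := countable_polynomial _
  obtain ⟨F, hF⟩ := exists_surjective_nat A.R[X]
  let G : ℕ → A.R[X] := fun j => if (F j).natDegree < d then F j else Q
  obtain ⟨y, hy⟩ := hE (fun j => (G j).map A.ψ) (fun j => D.v (((G j).map A.φ).eval x))
    (fun j => D.ac (((G j).map A.φ).eval x)) (fun n => by
      let S : Finset A.R[X] := insert (derivative Q)
        (((Finset.range n).image F).filter fun P => P.natDegree < d)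
      have hSd : ∀ P ∈ S, P.natDegree < d := by
        intro P hP
        obtain rfl | hP := Finset.mem_insert.1 hP
        · exact hd ▸ natDegree_derivative_lt hpos
        · exact (Finset.mem_filter.1 hP).2
      obtain ⟨B, ⟨i, hi, hi'⟩, c, hc⟩ := A.exists_center S x fun P hP => hext P (hSd P hP)
      have hmap := map_map_of_extends hi hi'
      obtain ⟨y, hQy, hy⟩ := B.exists_root_sameLead_eval x c (Q.map i) (by rwa [(hmap Q).1])
        (by rwa [(hmap Q).1]) {P' | ∃ P ∈ S, P.map i = P'}
        ⟨_, Finset.mem_insert_self _ _, (derivative_map _ _).symm⟩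
        (by
          rintro _ ⟨P, hP, rfl⟩ j z
          rw [(hmap P).1]
          exact hc P hP j z)
      refine ⟨y, fun j hj => ?_⟩
      change SameLead D E (((G j).map A.φ).eval x) (((G j).map A.ψ).eval y)
      dsimp only [G]
      split_ifs with hdj
      · have := hy _ ⟨F j, Finset.mem_insert_of_mem (Finset.mem_filter.2
          ⟨Finset.mem_image_of_mem _ (Finset.mem_range.2 hj), hdj⟩), rfl⟩
        rwa [(hmap _).1, (hmap _).2] at this
      · rw [(hmap Q).2] at hQy
        rw [hQx, hQy]
        exact sameLead_zero)
  replace hy : ∀ j, SameLead D E (((G j).map A.φ).eval x) (((G j).map A.ψ).eval y) := hy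
  have hQy : (Q.map A.ψ).eval y = 0 := by
    obtain ⟨j, hj⟩ := hF Q
    have := hy j
    simp only [G, hj, hd, lt_irrefl, if_false] at this
    exact this.eq_zero_iff.1 hQx
  refine ⟨y, fun P => ?_⟩
  induction hn : P.natDegree using Nat.strong_induction_on generalizing P with
  | _ n ihn =>
  by_cases hPd : P.natDegree < d
  · obtain ⟨j, rfl⟩ := hF P
    simpa only [G, hPd, if_true] using hy j
  · have hlt := natDegree_cancelLeads_lt_of_natDegree_le_natDegree (p := Q) (q := P) (by omega)
      (by omega)
    have h1 := ihn _ (hn ▸ hlt) _ rfl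
    have h2 : ∀ {M : Type} [Field M] (θ : A.R →+* M) (w : M), (Q.map θ).eval w = 0 →
        ((Q.cancelLeads P).map θ).eval w = θ Q.leadingCoeff * (P.map θ).eval w := by
      intro M _ θ w hw
      have h3 : Q.natDegree - P.natDegree = 0 := by omega
      simp [cancelLeads, hw, h3]
    rw [h2 _ _ hQx, h2 _ _ hQy] at h1
    exact (A.compat _).of_mul hlead h1

lemma exists_canMap [CharZero k] (hE : E.Saturated) (A : PartialIso D E) (x : K) :
    ∃ y, A.CanMap x y := by
  classical
  have : Countable A.R[X] := countable_polynomial _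
  obtain ⟨F, hF⟩ := exists_surjective_nat A.R[X]
  obtain ⟨y, hy⟩ := hE (fun j => (F j).map A.ψ) (fun j => D.v (((F j).map A.φ).eval x))
    (fun j => D.ac (((F j).map A.φ).eval x)) (fun n => by
      obtain ⟨B, ⟨i, hi, hi'⟩, c, hc⟩ := A.exists_center ((Finset.range n).image F) x (by
        rintro G - j z h0 hz B ⟨i, hi, hi'⟩
        have hm : (derivative^[j] (G.map i)).map B.φ = derivative^[j] (G.map A.φ) := by
          rw [← iterate_derivative_map, (map_map_of_extends hi hi' G).1]
        exact exists_canMap_of_root hE _ B z (derivative^[j] (G.map i)) rfl (by rwa [hm])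
          (by rwa [hm]))
      have hmap := map_map_of_extends hi hi'
      obtain ⟨y, hy⟩ := B.exists_sameLead_eval x c
        {P' | ∃ P ∈ (Finset.range n).image F, P.map i = P'} (by
          rintro _ ⟨P, hP, rfl⟩ j z
          rw [(hmap P).1]
          exact hc P hP j z)
      refine ⟨y, fun j hj => ?_⟩
      have := hy _ ⟨F j, Finset.mem_image_of_mem _ (Finset.mem_range.2 hj), rfl⟩
      rwa [(hmap _).1, (hmap _).2] at this)
  refine ⟨y, fun P => ?_⟩
  obtain ⟨j, rfl⟩ := hF P
  exact hy j

lemma v_natCast_eq_ite [CharZero k] (D : AngularField K k Γ₀) (n : ℕ) :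
    D.v (n : K) = if n = 0 then 0 else 1 := by
  split_ifs with h
  · simp [h]
  · exact v_natCast h

lemma ac_natCast [CharZero k] (D : AngularField K k Γ₀) (n : ℕ) : D.ac (n : K) = n := by
  obtain rfl | hn := eq_or_ne n 0
  · simp
  · rw [← lead_self, v_natCast hn, lead_one_natCast]

lemma ac_neg_natCast [CharZero k] (D : AngularField K k Γ₀) (n : ℕ) : D.ac (-(n : K)) = -n := by
  obtain rfl | hn := eq_or_ne n 0
  · simp
  · have h := lead_add (D := D) (γ := 1) one_ne_zero (x := -(n : K)) (y := n)
      (by rw [Valuation.map_neg, v_natCast hn]) (v_natCast hn).le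
    rw [neg_add_cancel, lead_one_natCast] at h
    have h0 : D.lead 1 (0 : K) = 0 := by simpa using lead_one_natCast (D := D) 0
    rw [← lead_self, Valuation.map_neg, v_natCast hn, eq_neg_iff_add_eq_zero, ← h, h0]

/-- The partial isomorphism between the prime rings. -/
def prime (D : AngularField K k Γ₀) (E : AngularField L k Γ₀) [CharZero k] : PartialIso D E where
  R := ℤ
  φ := Int.castRingHom K
  ψ := Int.castRingHom L
  compat r := by
    obtain ⟨n, rfl | rfl⟩ := r.eq_nat_or_neg
    · exact ⟨by simp [v_natCast_eq_ite D, v_natCast_eq_ite E],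
        by simp [ac_natCast D, ac_natCast E]⟩
    · exact ⟨by simp [v_natCast_eq_ite D, v_natCast_eq_ite E],
        by simp [ac_neg_natCast D, ac_neg_natCast E]⟩

end PartialIso

/-- Solvability of forms with prescribed support transfers between saturated fields. -/
lemma exists_zero_transfer [CharZero k] (D : AngularField K k Γ₀) (E : AngularField L k Γ₀)
    (hD : D.Saturated) (hE : E.Saturated) {σ : Type} [Finite σ] (f : MvPolynomial σ K)
    (h : ∀ g : MvPolynomial σ L, g.support ⊆ f.support →
      ∃ y : σ → L, y ≠ 0 ∧ MvPolynomial.eval y g = 0) :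
    ∃ x : σ → K, x ≠ 0 ∧ MvPolynomial.eval x f = 0 := by
  classical
  cases nonempty_fintype σ
  obtain ⟨B, -, hB⟩ := (PartialIso.prime D E).exists_extends_finset
    (f.support.image f.coeff) fun z _ C _ => C.exists_canMap hE z
  choose! r hr using hB
  let F : MvPolynomial σ B.R := ∑ m ∈ f.support, MvPolynomial.monomial m (r (f.coeff m))
  have hF : F.map B.φ = f := by
    conv_rhs => rw [f.as_sum]
    rw [map_sum]
    refine Finset.sum_congr rfl fun m hm => ?_
    rw [MvPolynomial.map_monomial, hr _ (Finset.mem_image_of_mem _ hm)]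
  obtain ⟨y, hy, hy0⟩ := h (F.map B.ψ) (by
    refine (MvPolynomial.support_map_subset _ _).trans ?_
    refine (MvPolynomial.support_sum).trans ?_
    refine Finset.biUnion_subset.2 fun m hm => ?_
    exact MvPolynomial.support_monomial_subset.trans (Finset.singleton_subset_iff.2 hm))
  obtain ⟨C, hext, hC⟩ := B.symm.exists_extends_finset (Finset.univ.image y)
    fun z _ C _ => C.exists_canMap hD z
  obtain ⟨i, hi, hi'⟩ : ∃ i : B.R →+* C.R, C.φ.comp i = B.ψ ∧ C.ψ.comp i = B.φ := hext
  choose! s hs using hC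
  replace hs : ∀ j, C.φ (s (y j)) = y j := fun j => hs _ (by simp)
  refine ⟨fun j => C.ψ (s (y j)), fun h0 => hy ?_, ?_⟩
  · ext j
    have := congrFun h0 j
    rw [← hs j]
    exact (C.compat _).eq_zero_iff.2 this
  · have h1 : C.φ (F.eval₂ i fun j => s (y j)) = 0 := by
      rw [MvPolynomial.hom_eval₂]
      simp only [hi, hs]
      rwa [MvPolynomial.eval_map] at hy0
    have h2 := (C.compat _).eq_zero_iff.1 h1
    rw [MvPolynomial.hom_eval₂] at h2
    rw [← hF, MvPolynomial.eval_map, ← h2, hi']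

end Pair

end AngularField

/-- Hensel's lemma for a polynomial that need not be monic. -/
lemma HenselianLocalRing.exists_root {R : Type*} [CommRing R] [HenselianLocalRing R] (f : R[X])
    (a : R) (h : f.eval a ∈ IsLocalRing.maximalIdeal R) (h' : IsUnit (f.derivative.eval a)) :
    ∃ z, f.eval z = 0 ∧ z - a ∈ IsLocalRing.maximalIdeal R := by
  obtain ⟨c, hc⟩ := h'.exists_right_inv
  set n := f.natDegree
  set u := f.eval a with hu
  let e : ℕ → R := fun j => (taylor a f).coeff (j + 2) * (-c) ^ (j + 2) * u ^ (j + 1)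
  have he : ∀ j, e j ∈ IsLocalRing.maximalIdeal R := fun j => by
    have : e j = (taylor a f).coeff (j + 2) * (-c) ^ (j + 2) * u ^ j * u := by simp only [e]; ring
    rw [this]
    exact Ideal.mul_mem_left _ _ h
  let M : R[X] := X ^ (n + 1 + 1) +
    (-X ^ (n + 1) + ∑ j ∈ Finset.range (n + 1), C (e j) * X ^ (n - j))
  have hM : M.Monic := by
    refine monic_X_pow_add (lt_of_le_of_lt (b := ((n + 1 : ℕ) : WithBot ℕ)) ?_
      (by exact_mod_cast (n + 1).lt_succ_self))
    refine (degree_add_le _ _).trans (max_le ?_ ?_)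
    · rw [degree_neg]
      exact degree_X_pow_le _
    · refine (degree_sum_le _ _).trans (Finset.sup_le fun j _ => ?_)
      refine (degree_C_mul_X_pow_le _ _).trans ?_
      exact_mod_cast (Nat.sub_le n j).trans n.le_succ
  obtain ⟨W, hW, hW1⟩ := HenselianLocalRing.is_henselian M hM 1
    (by
      simp only [M, eval_add, eval_neg, eval_pow, eval_X, one_pow, eval_finsetSum, eval_mul, eval_C,
        mul_one, add_neg_cancel_left]
      exact Ideal.sum_mem _ fun j _ => he j)
    (by
      have : M.derivative.eval 1 = 1 + ∑ j ∈ Finset.range (n + 1), e j * (n - j : ℕ) := by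
        simp only [M, derivative_add, derivative_X_pow, derivative_neg, derivative_sum,
          derivative_C_mul, eval_add, eval_finsetSum, eval_neg, eval_mul, eval_C, eval_pow,
          eval_X, one_pow, mul_one]
        push_cast
        ring
      rw [this]
      by_contra hcon
      have h2 := (IsLocalRing.mem_maximalIdeal _).2 hcon
      refine Ideal.one_notMem (IsLocalRing.maximalIdeal R) ?_
      rw [← add_sub_cancel_right (1 : R)]
      exact Ideal.sub_mem _ h2 (Ideal.sum_mem _ fun j _ => Ideal.mul_mem_right _ _ (he j)))
  have hWu : IsUnit W := by
    by_contra hcon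
    refine Ideal.one_notMem (IsLocalRing.maximalIdeal R) ?_
    rw [← sub_sub_cancel W 1]
    exact Ideal.sub_mem _ ((IsLocalRing.mem_maximalIdeal _).2 hcon) hW1
  obtain ⟨w, hw⟩ := hWu.exists_right_inv
  refine ⟨-c * u * w + a, ?_, ?_⟩
  · rw [← taylor_eval, eval_eq_sum_range' (n := n + 1 + 1 + 1) (by rw [natDegree_taylor]; omega),
      Finset.sum_range_succ', Finset.sum_range_succ', taylor_coeff_zero, zero_add, taylor_coeff_one,
      ← hu]
    have hWM : u * w ^ (n + 1 + 1) * M.eval W = 0 := by rw [hW.eq_zero, mul_zero]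
    rw [← hWM]
    simp only [M, eval_add, eval_neg, eval_pow, eval_X, eval_finsetSum, eval_mul, eval_C, mul_add]
    rw [add_assoc, add_comm, add_comm _ (u * _), Finset.mul_sum]
    have hpow : ∀ i j, w ^ (i + j) * W ^ j = w ^ i := fun i j => by
      rw [pow_add, mul_assoc, ← mul_pow, mul_comm w, hw, one_pow, mul_one]
    have hsum : ∀ i ∈ Finset.range (n + 1), u * w ^ (n + 1 + 1) * (e i * W ^ (n - i)) =
        (taylor a f).coeff (i + 1 + 1) * (-c * u * w) ^ (i + 1 + 1) := fun i hi => by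
      have h1 : n + 1 + 1 = (i + 1 + 1) + (n - i) := by
        have := Finset.mem_range.1 hi
        omega
      have h2 := hpow (i + 1 + 1) (n - i)
      rw [← h1] at h2
      linear_combination (u * e i) * h2
    have h0 := hpow 0 (n + 1 + 1)
    have h1 := hpow 1 (n + 1)
    rw [Finset.sum_congr rfl hsum]
    rw [zero_add] at h0
    rw [add_comm 1] at h1
    linear_combination (-u * w) * hc - u * h0 + u * h1
  · rw [add_sub_cancel_right]
    exact Ideal.mul_mem_right _ _ (Ideal.mul_mem_left _ _ h)

instance PowerSeries.henselianLocalRing {F : Type*} [Field F] :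
    HenselianLocalRing (PowerSeries F) := by
  have : HenselianRing (PowerSeries F) (IsLocalRing.maximalIdeal (PowerSeries F)) := by
    rw [PowerSeries.maximalIdeal_eq_span_X]; infer_instance
  refine ⟨fun f hf a h h' => HenselianRing.is_henselian f hf a h (h'.map _)⟩
instance PadicInt.henselianLocalRing {p : ℕ} [Fact p.Prime] : HenselianLocalRing ℤ_[p] := by
  refine ⟨fun f hf a h h' => HenselianRing.is_henselian f hf a h (h'.map _)⟩

namespace AngularField

section OfDVR

variable {O K k : Type*} [CommRing O] [IsDomain O] [IsDiscreteValuationRing O]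
  [HenselianLocalRing O] [Field K] [Algebra O K] [IsFractionRing O K] [Field k]

/-- The angular field structure on the fraction field of a henselian discrete valuation ring. -/
theorem nonempty_of_dvr (ρ : O →+* k) (hρ : Function.Surjective ρ) :
    Nonempty (AngularField K k ℤᵐ⁰) := by
  set v := (IsDiscreteValuationRing.maximalIdeal O).valuation K with hv
  have hker : RingHom.ker ρ = IsLocalRing.maximalIdeal O :=
    IsLocalRing.eq_maximalIdeal (RingHom.ker_isMaximal_of_surjective ρ hρ)
  have hmem : ∀ a : O, v (algebraMap O K a) < 1 ↔ ρ a = 0 := fun a => by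
    rw [← RingHom.mem_ker, hker]
    exact IsDedekindDomain.HeightOneSpectrum.valuation_lt_one_iff_mem _ a
  have hle : ∀ a : O, v (algebraMap O K a) ≤ 1 := fun a =>
    IsDedekindDomain.HeightOneSpectrum.valuation_le_one _ a
  have hlift : ∀ x : K, v x ≤ 1 → ∃ a : O, algebraMap O K a = x := fun x hx =>
    IsDiscreteValuationRing.exists_lift_of_le_one hx
  have hinj := IsFractionRing.injective O K
  choose! l hl using hlift
  have hl' : ∀ a : O, l (algebraMap O K a) = a := fun a => hinj (hl _ (hle a))
  obtain ⟨π, hπ⟩ := (IsDiscreteValuationRing.maximalIdeal O).valuation_exists_uniformizer K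
  have hπ0 : π ≠ 0 := fun h => WithZero.exp_ne_zero (hπ.symm.trans (by rw [h, map_zero]))
  let N : K → K := fun x => x * π ^ WithZero.log (v x)
  have hN : ∀ x, v (N x) ≤ 1 := fun x => by
    obtain rfl | hx := eq_or_ne x 0
    · simp [N]
    · have : v x ≠ 0 := by simpa using hx
      simp only [N, map_mul, map_zpow₀]
      rw [← hv] at hπ
      rw [hπ]
      conv_lhs => rw [← WithZero.exp_log this]
      rw [← WithZero.exp_zsmul]
      simp
  have hmul : ∀ x y, N (x * y) = N x * N y := fun x y => by
    by_cases hx : x = 0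
    · simp [N, hx]
    by_cases hy : y = 0
    · simp [N, hy]
    simp only [N, map_mul]
    rw [WithZero.log_mul (by simpa using hx) (by simpa using hy), zpow_add₀ hπ0]
    ring
  have hN1 : ∀ x, v x = 1 → N x = x := fun x hx => by simp [N, hx]
  let r : K → k := fun x => ρ (l x)
  have hradd : ∀ x y, v x ≤ 1 → v y ≤ 1 → r (x + y) = r x + r y := fun x y hx hy => by
    have : l (x + y) = l x + l y := by rw [← hl' (l x + l y), map_add, hl x hx, hl y hy]
    simp only [r, this, map_add]
  have hrmul : ∀ x y, v x ≤ 1 → v y ≤ 1 → r (x * y) = r x * r y := fun x y hx hy => by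
    have : l (x * y) = l x * l y := by rw [← hl' (l x * l y), map_mul, hl x hx, hl y hy]
    simp only [r, this, map_mul]
  have hr0 : ∀ x, v x < 1 → r x = 0 := fun x hx => (hmem _).1 (by rwa [hl x hx.le])
  have hr : ∀ x, v x ≤ 1 → (if v x = 1 then r (N x) else 0) = r x := fun x hx => by
    split_ifs with h
    · rw [hN1 x h]
    · exact (hr0 x (lt_of_le_of_ne hx h)).symm
  refine ⟨{ v := v
            ac := ⟨⟨fun x => r (N x), ?_⟩, ?_, ?_⟩
            ac_add := ?_
            exists_lift := ?_
            hensel := ?_ }⟩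
  · exact hr0 _ (by simp [N])
  · have : N 1 = algebraMap O K 1 := by simp [N]
    change ρ (l (N 1)) = 1
    rw [this, hl', map_one]
  · intro x y
    change r (N (x * y)) = r (N x) * r (N y)
    rw [hmul, hrmul _ _ (hN x) (hN y)]
  · intro x y hx hy
    have h := hradd x y hx hy
    rw [← hr x hx, ← hr y hy, ← hr _ (v.map_add_le hx hy)] at h
    exact h
  · intro γ u hγ hu
    obtain ⟨a, rfl⟩ := hρ u
    have hva : v (algebraMap O K a) = 1 :=
      le_antisymm (hle a) (not_lt.1 fun h => hu ((hmem a).1 h))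
    have hvx : v (algebraMap O K a * π ^ (-WithZero.log γ)) = γ := by
      rw [map_mul, hva, one_mul, map_zpow₀, hπ, ← WithZero.exp_zsmul]
      simp [WithZero.exp_log hγ]
    refine ⟨algebraMap O K a * π ^ (-WithZero.log γ), hvx, ?_⟩
    change ρ (l (_ * π ^ WithZero.log (v _))) = ρ a
    rw [hvx, mul_assoc, ← zpow_add₀ hπ0, neg_add_cancel, zpow_zero, mul_one, hl']
  · intro P hP h1 h2
    obtain ⟨Q, rfl⟩ := (Polynomial.lifts_iff_coeff_lifts P).2 fun i =>
      (⟨l (P.coeff i), hl _ (hP i)⟩ : P.coeff i ∈ Set.range (algebraMap O K))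
    rw [coe_mapRingHom] at h1 h2 ⊢
    have hev : ∀ (F : O[X]) a, (F.map (algebraMap O K)).eval (algebraMap O K a) =
        algebraMap O K (F.eval a) := fun F a => by
      rw [eval_map_algebraMap, aeval_algebraMap_apply_eq_algebraMap_eval]
    rw [derivative_map] at h2
    have h11 := hev Q 1
    have h21 := hev (derivative Q) 1
    rw [map_one] at h11 h21
    rw [h11, hmem, ← RingHom.mem_ker, hker] at h1
    obtain ⟨z, hz, hz1⟩ := HenselianLocalRing.exists_root Q 1 h1 (by
      by_contra hcon
      rw [h21] at h2
      have := (IsLocalRing.mem_maximalIdeal _).2 hcon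
      rw [← hker, RingHom.mem_ker, ← hmem] at this
      exact this.ne h2)
    refine ⟨algebraMap O K z, by rw [hev, hz, map_zero], ?_⟩
    rw [← hker, RingHom.mem_ker, ← hmem] at hz1
    simpa using hz1

theorem nonempty_padic (p : ℕ) [Fact p.Prime] : Nonempty (AngularField ℚ_[p] (ZMod p) ℤᵐ⁰) :=
  nonempty_of_dvr PadicInt.toZMod (ZMod.ringHom_surjective _)

theorem nonempty_laurentSeries (F : Type*) [Field F] :
    Nonempty (AngularField (LaurentSeries F) F ℤᵐ⁰) :=
  nonempty_of_dvr PowerSeries.constantCoeff fun a => ⟨PowerSeries.C a, by simp⟩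

end OfDVR

end AngularField

noncomputable instance Filter.Germ.instLinearOrderedCommGroupWithZero {α Γ : Type*}
    {U : Ultrafilter α} [LinearOrderedCommGroupWithZero Γ] :
    LinearOrderedCommGroupWithZero (Germ (U : Filter α) Γ) where
  __ := (inferInstance : CommMonoid (Germ (U : Filter α) Γ))
  __ := (inferInstance : LinearOrder (Germ (U : Filter α) Γ))
  __ := (inferInstance : GroupWithZero (Germ (U : Filter α) Γ))
  __ := (inferInstance : OrderBot (Germ (U : Filter α) Γ))
  isBot_zero := fun x => Germ.inductionOn x fun _ =>
    Germ.coe_le.2 (Eventually.of_forall fun _ => zero_le)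
  mul_lt_mul_of_pos_left := fun {a} ha {b c} h => by
    induction a, b, c using Germ.inductionOn₃ with | _ a b c
    have ha' : ∀ᶠ j in U, 0 < a j := Germ.coe_lt.1 ha
    refine Germ.coe_lt.2 ?_
    filter_upwards [Germ.coe_lt.1 h, ha'] with j h1 h2
    exact mul_lt_mul_of_pos_left h1 h2

section Ultraproduct

variable (U : Ultrafilter ℕ) (F : ℕ → Type) [∀ j, Field (F j)]

/-- The ideal of families vanishing almost everywhere. -/
def ultraIdeal : Ideal (∀ j, F j) where
  carrier := {a | ∀ᶠ j in U, a j = 0}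
  add_mem' {a b} ha hb := by
    filter_upwards [ha, hb] with j h1 h2
    rw [Pi.add_apply, h1, h2, add_zero]
  zero_mem' := Eventually.of_forall fun _ => rfl
  smul_mem' c a ha := by
    filter_upwards [ha] with j h
    rw [smul_eq_mul, Pi.mul_apply, h, mul_zero]

instance ultraIdeal_isMaximal : (ultraIdeal U F).IsMaximal := by
  classical
  rw [Ideal.isMaximal_iff]
  refine ⟨fun h => ?_, fun J a hJ ha haJ => ?_⟩
  · have h1 : ∀ᶠ j in (U : Filter ℕ), (1 : ∀ j, F j) j = 0 := h
    obtain ⟨j, hj⟩ := h1.exists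
    exact one_ne_zero hj
  · have h : ∀ᶠ j in U, a j ≠ 0 := Ultrafilter.eventually_not.2 ha
    have h1 : (1 - a⁻¹ * a) ∈ J := by
      refine hJ ?_
      change ∀ᶠ j in U, (1 - a⁻¹ * a) j = 0
      filter_upwards [h] with j hj
      simp [hj]
    simpa using J.add_mem h1 (J.mul_mem_left a⁻¹ haJ)

/-- The ultraproduct of a sequence of fields. -/
abbrev UProd : Type := (∀ j, F j) ⧸ ultraIdeal U F

noncomputable instance : Field (UProd U F) := Ideal.Quotient.field _

namespace UProd

variable {F}

/-- The class of a family in the ultraproduct. -/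
abbrev ofPi : (∀ j, F j) →+* UProd U F := Ideal.Quotient.mk _

variable {U}

lemma exists_rep (x : UProd U F) : ∃ a, ofPi U a = x := Ideal.Quotient.mk_surjective x

lemma ofPi_eq_zero {a : ∀ j, F j} : ofPi U a = 0 ↔ ∀ᶠ j in U, a j = 0 :=
  Ideal.Quotient.eq_zero_iff_mem

lemma ofPi_eq_ofPi {a b : ∀ j, F j} : ofPi U a = ofPi U b ↔ ∀ᶠ j in U, a j = b j := by
  rw [← sub_eq_zero, ← map_sub, ofPi_eq_zero]
  simp only [Pi.sub_apply, sub_eq_zero]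

/-- A representative of an element of the ultraproduct. -/
noncomputable def rep (x : UProd U F) : ∀ j, F j := (exists_rep x).choose

@[simp] lemma ofPi_rep (x : UProd U F) : ofPi U x.rep = x := (exists_rep x).choose_spec

lemma eventually_rep (a : ∀ j, F j) : ∀ᶠ j in U, (ofPi U a).rep j = a j :=
  ofPi_eq_ofPi.1 (ofPi_rep _)

lemma charZero (h : ∀ n : ℕ, n ≠ 0 → ∀ᶠ j in U, (n : F j) ≠ 0) : CharZero (UProd U F) := by
  refine charZero_of_inj_zero fun n hn => ?_
  by_contra h0
  rw [← map_natCast (ofPi U), ofPi_eq_zero] at hn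
  obtain ⟨j, h1, h2⟩ := (hn.and (h n h0)).exists
  exact h2 h1

lemma exists_family {C : ∀ j, F j → Prop} (h : ∀ᶠ j in U, ∃ y, C j y) :
    ∃ a : ∀ j, F j, ∀ᶠ j in U, C j (a j) := by
  have h' : ∀ j, ∃ y, (∃ y, C j y) → C j y := fun j => by
    by_cases hj : ∃ y, C j y
    · exact ⟨hj.choose, fun _ => hj.choose_spec⟩
    · exact ⟨0, fun h0 => absurd h0 hj⟩
  choose a ha using h'
  exact ⟨a, h.mono ha⟩

lemma eval_map_ofPi (P : (∀ j, F j)[X]) (a : ∀ j, F j) :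
    (P.map (ofPi U)).eval (ofPi U a) = ofPi U fun j => (P.map (Pi.evalRingHom F j)).eval (a j) := by
  rw [eval_map, eval₂_at_apply]
  congr 1
  ext j
  rw [eval_map, ← Pi.evalRingHom_apply F j a, eval₂_at_apply]
  rfl

lemma mvEval_map_ofPi {σ : Type*} (P : MvPolynomial σ (∀ j, F j)) (a : σ → ∀ j, F j) :
    MvPolynomial.eval (fun s => ofPi U (a s)) (P.map (ofPi U)) =
      ofPi U fun j => MvPolynomial.eval (fun s => a s j) (P.map (Pi.evalRingHom F j)) := by
  have h1 := MvPolynomial.eval₂_comp (ofPi U) a P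
  rw [MvPolynomial.eval_map]
  refine Eq.trans (Eq.symm h1) (congrArg (ofPi U) (funext fun j => ?_))
  rw [MvPolynomial.eval_map]
  exact MvPolynomial.eval₂_comp (Pi.evalRingHom F j) a P

end UProd

namespace AngularField

variable {U F} {k : ℕ → Type} [∀ j, Field (k j)] {Γ : Type} [LinearOrderedCommGroupWithZero Γ]
variable (D : ∀ j, AngularField (F j) (k j) Γ)

open UProd

/-- The valuation on an ultraproduct. -/
noncomputable def ultraV (x : UProd U F) : Germ (U : Filter ℕ) Γ :=
  (fun j => (D j).v (x.rep j) : ℕ → Γ)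

/-- The angular component on an ultraproduct. -/
noncomputable def ultraAc (x : UProd U F) : UProd U k := ofPi U fun j => (D j).ac (x.rep j)

lemma ultraV_ofPi (a : ∀ j, F j) :
    ultraV D (ofPi U a) = ((fun j => (D j).v (a j) : ℕ → Γ) : Germ (U : Filter ℕ) Γ) := by
  refine Germ.coe_eq.2 ?_
  filter_upwards [eventually_rep (U := U) a] with j hj
  rw [hj]

lemma ultraAc_ofPi (a : ∀ j, F j) : ultraAc D (ofPi U a) = ofPi U fun j => (D j).ac (a j) := by
  refine ofPi_eq_ofPi.2 ?_
  filter_upwards [eventually_rep (U := U) a] with j hj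
  rw [hj]

lemma ultraV_lt_one {a : ∀ j, F j} : ultraV D (ofPi U a) < 1 ↔ ∀ᶠ j in U, (D j).v (a j) < 1 := by
  rw [ultraV_ofPi]; exact Germ.coe_lt

lemma ultraV_le_one {a : ∀ j, F j} : ultraV D (ofPi U a) ≤ 1 ↔ ∀ᶠ j in U, (D j).v (a j) ≤ 1 := by
  rw [ultraV_ofPi]; exact Germ.coe_le

lemma ultraV_eq_one {a : ∀ j, F j} : ultraV D (ofPi U a) = 1 ↔ ∀ᶠ j in U, (D j).v (a j) = 1 := by
  rw [ultraV_ofPi]; exact Germ.coe_eq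

lemma ultraAc_lead (a : ∀ j, F j) :
    (if ultraV D (ofPi U a) = 1 then ultraAc D (ofPi U a) else 0) =
      ofPi U fun j => if (D j).v (a j) = 1 then (D j).ac (a j) else 0 := by
  split_ifs with h
  · rw [ultraAc_ofPi, ofPi_eq_ofPi]
    filter_upwards [(ultraV_eq_one D).1 h] with j hj
    rw [if_pos hj]
  · rw [ultraV_eq_one, ← Ultrafilter.eventually_not] at h
    rw [eq_comm, ofPi_eq_zero]
    filter_upwards [h] with j hj
    rw [if_neg hj]

lemma ultra_hensel (P : (UProd U F)[X]) (hP : ∀ i, ultraV D (P.coeff i) ≤ 1)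
    (h1 : ultraV D (P.eval 1) < 1) (h2 : ultraV D (P.derivative.eval 1) = 1) :
    ∃ z, P.eval z = 0 ∧ ultraV D (z - 1) < 1 := by
  obtain ⟨Q, rfl⟩ := map_surjective (ofPi U) Ideal.Quotient.mk_surjective P
  have hco : ∀ᶠ j in U, ∀ i, (D j).v ((Q.map (Pi.evalRingHom F j)).coeff i) ≤ 1 := by
    have : ∀ᶠ j in U, ∀ i ∈ Finset.range (Q.natDegree + 1), (D j).v (Q.coeff i j) ≤ 1 := by
      rw [Filter.eventually_all_finset]
      exact fun i _ => (ultraV_le_one D).1 (by simpa using hP i)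
    filter_upwards [this] with j hj i
    rw [coeff_map]
    by_cases hi : i ∈ Finset.range (Q.natDegree + 1)
    · exact hj i hi
    · rw [coeff_eq_zero_of_natDegree_lt (by simpa using hi)]
      simp
  rw [← map_one (ofPi U), eval_map_ofPi, ultraV_lt_one] at h1
  rw [← map_one (ofPi U), derivative_map, eval_map_ofPi, ultraV_eq_one] at h2
  have hz : ∀ᶠ j in U, ∃ z, (Q.map (Pi.evalRingHom F j)).eval z = 0 ∧ (D j).v (z - 1) < 1 := by
    filter_upwards [hco, h1, h2] with j h3 h4 h5
    exact (D j).hensel _ h3 h4 (by rw [derivative_map]; exact h5)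
  obtain ⟨z, hz⟩ := exists_family hz
  refine ⟨ofPi U z, ?_, ?_⟩
  · rw [eval_map_ofPi, ofPi_eq_zero]
    exact hz.mono fun j hj => hj.1
  · rw [← map_one (ofPi U), ← map_sub, ultraV_lt_one]
    exact hz.mono fun j hj => hj.2

/-- The angular field structure on an ultraproduct. -/
noncomputable def ultra : AngularField (UProd U F) (UProd U k) (Germ (U : Filter ℕ) Γ) where
  v :=
    { toFun := ultraV D
      map_zero' := by
        rw [← map_zero (ofPi U), ultraV_ofPi]
        simp only [Pi.zero_apply, map_zero]
        rfl
      map_one' := by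
        rw [← map_one (ofPi U), ultraV_ofPi]
        simp only [Pi.one_apply, map_one]
        rfl
      map_mul' := fun x y => by
        obtain ⟨a, rfl⟩ := exists_rep x
        obtain ⟨b, rfl⟩ := exists_rep y
        rw [← map_mul, ultraV_ofPi, ultraV_ofPi, ultraV_ofPi]
        simp only [Pi.mul_apply, map_mul]
        rfl
      map_add_le_max' := fun x y => by
        obtain ⟨a, rfl⟩ := exists_rep x
        obtain ⟨b, rfl⟩ := exists_rep y
        rw [← map_add, ultraV_ofPi, ultraV_ofPi, ultraV_ofPi, Germ.max_def]
        exact Germ.coe_le.2 (Eventually.of_forall fun j => (D j).v.map_add _ _) }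
  ac :=
    { toFun := ultraAc D
      map_zero' := by
        rw [← map_zero (ofPi U), ultraAc_ofPi]
        simp only [Pi.zero_apply, map_zero]
        exact map_zero (ofPi U)
      map_one' := by
        rw [← map_one (ofPi U), ultraAc_ofPi]
        simp only [Pi.one_apply, map_one]
        exact map_one (ofPi U)
      map_mul' := fun x y => by
        obtain ⟨a, rfl⟩ := exists_rep x
        obtain ⟨b, rfl⟩ := exists_rep y
        rw [← map_mul, ultraAc_ofPi, ultraAc_ofPi, ultraAc_ofPi]
        simp only [Pi.mul_apply, map_mul]
        rfl }
  ac_add x y hx hy := by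
    obtain ⟨a, rfl⟩ := exists_rep x
    obtain ⟨b, rfl⟩ := exists_rep y
    change (if ultraV D _ = 1 then ultraAc D _ else 0) = (if ultraV D _ = 1 then ultraAc D _ else 0)
      + (if ultraV D _ = 1 then ultraAc D _ else 0)
    rw [← map_add, ultraAc_lead, ultraAc_lead, ultraAc_lead, ← map_add, ofPi_eq_ofPi]
    filter_upwards [(ultraV_le_one D).1 hx, (ultraV_le_one D).1 hy] with j h1 h2
    exact (D j).ac_add _ _ h1 h2
  exists_lift γ u hγ hu := by
    obtain ⟨w, rfl⟩ := exists_rep u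
    induction γ using Germ.inductionOn with | _ g
    have hg : ∀ᶠ j in U, g j ≠ 0 := Ultrafilter.eventually_not.2 fun h => hγ (Germ.coe_eq.2 h)
    have hw : ∀ᶠ j in U, w j ≠ 0 := Ultrafilter.eventually_not.2 fun h => hu (ofPi_eq_zero.2 h)
    have hx : ∀ᶠ j in U, ∃ x, (D j).v x = g j ∧ (D j).ac x = w j := by
      filter_upwards [hg, hw] with j h1 h2
      exact (D j).exists_lift _ _ h1 h2
    obtain ⟨x, hx⟩ := exists_family hx
    refine ⟨ofPi U x, (ultraV_ofPi D x).trans (Germ.coe_eq.2 ?_),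
      (ultraAc_ofPi D x).trans (ofPi_eq_ofPi.2 ?_)⟩
    · exact hx.mono fun j hj => hj.1
    · exact hx.mono fun j hj => hj.2
  hensel := ultra_hensel D

lemma ultra_saturated (hU : (U : Filter ℕ) ≤ atTop) : (ultra (U := U) D).Saturated := by
  classical
  intro P γ u h
  choose Q hQ using fun i => map_surjective (ofPi U) Ideal.Quotient.mk_surjective (P i)
  choose w hw using fun i => exists_rep (u i)
  choose g hg using fun i => Quotient.exists_rep (γ i)
  let C : ℕ → ∀ j, F j → Prop := fun i j y =>
    g i j = (D j).v (((Q i).map (Pi.evalRingHom F j)).eval y) ∧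
      w i j = (D j).ac (((Q i).map (Pi.evalRingHom F j)).eval y)
  have key : ∀ i (a : ∀ j, F j), (γ i = (ultra D).v ((P i).eval (ofPi U a)) ∧
      u i = (ultra D).ac ((P i).eval (ofPi U a))) ↔ ∀ᶠ j in U, C i j (a j) := fun i a => by
    change (γ i = ultraV D _ ∧ u i = ultraAc D _) ↔ _
    rw [← hQ, ← hw, ← hg, eval_map_ofPi, ultraV_ofPi, ultraAc_ofPi, ofPi_eq_ofPi,
      Filter.eventually_and]
    exact Iff.and Germ.coe_eq Iff.rfl
  have hfin : ∀ n, ∀ᶠ j in U, ∃ y, ∀ i < n, C i j y := fun n => by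
    obtain ⟨y, hy⟩ := h n
    obtain ⟨a, rfl⟩ := exists_rep y
    have : ∀ᶠ j in U, ∀ i ∈ Finset.range n, C i j (a j) := by
      rw [Filter.eventually_all_finset]
      exact fun i hi => (key i a).1 (hy i (Finset.mem_range.1 hi))
    exact this.mono fun j hj => ⟨a j, fun i hi => hj i (Finset.mem_range.2 hi)⟩
  have hN : ∀ j, ∃ y, ∀ i < Nat.findGreatest (fun n => ∃ y, ∀ i < n, C i j y) j, C i j y :=
    fun j => Nat.findGreatest_spec (P := fun n => ∃ y, ∀ i < n, C i j y) (Nat.zero_le j)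
      ⟨0, by simp⟩
  choose a ha using hN
  refine ⟨ofPi U a, fun i => (key i a).2 ?_⟩
  filter_upwards [hfin (i + 1), hU (eventually_ge_atTop (i + 1))] with j h1 h2
  exact ha j i (Nat.le_findGreatest h2 h1)

end AngularField

end Ultraproduct

end ValuedFields

section Forms

open Filter

lemma MvPolynomial.IsHomogeneous.eval_mul {σ R : Type*} [CommRing R] {g : MvPolynomial σ R} {d : ℕ}
    (hg : g.IsHomogeneous d) (c : R) (y : σ → R) :
    MvPolynomial.eval (fun i => c * y i) g = c ^ d * MvPolynomial.eval y g := by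
  rw [MvPolynomial.eval_eq, MvPolynomial.eval_eq, Finset.mul_sum]
  refine Finset.sum_congr rfl fun m hm => ?_
  have hdeg : ∑ i ∈ m.support, m i = d := by
    rw [← hg (MvPolynomial.mem_support_iff.1 hm), Finsupp.weight_apply, Finsupp.sum]
    simp
  simp only [mul_pow]
  rw [Finset.prod_mul_distrib, Finset.prod_pow_eq_pow_sum, hdeg]
  ring

namespace PowerSeries

variable {σ : Type*}

/-- If all coefficients of the series `Y i` are linear forms, the coefficients of the value at `Y`
of a form of degree `d` are forms of degree `d`. -/
lemma isHomogeneous_coeff_eval₂ {τ F : Type*} [CommRing F]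
    (Y : σ → PowerSeries (MvPolynomial τ F)) (hY : ∀ i e, (coeff e (Y i)).IsHomogeneous 1) {d : ℕ}
    {g : MvPolynomial σ (PowerSeries F)} (hg : g.IsHomogeneous d) (e : ℕ) :
    (coeff e (g.eval₂ (map MvPolynomial.C) Y)).IsHomogeneous d := by
  classical
  have hmul : ∀ {m n : ℕ} {A B : PowerSeries (MvPolynomial τ F)},
      (∀ e, (coeff e A).IsHomogeneous m) → (∀ e, (coeff e B).IsHomogeneous n) →
      ∀ e, (coeff e (A * B)).IsHomogeneous (m + n) := fun hA hB e => by
    rw [coeff_mul]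
    exact MvPolynomial.IsHomogeneous.sum _ _ _ fun x _ => (hA _).mul (hB _)
  have hone : ∀ e, (coeff e (1 : PowerSeries (MvPolynomial τ F))).IsHomogeneous 0 := fun e => by
    rw [coeff_one]
    split_ifs
    · exact MvPolynomial.isHomogeneous_one _ _
    · exact MvPolynomial.isHomogeneous_zero _ _ _
  have hpow : ∀ i n e, (coeff e (Y i ^ n)).IsHomogeneous n := fun i n => by
    induction n with
    | zero => simpa only [pow_zero] using hone
    | succ n ih =>
      rw [pow_succ]
      exact hmul ih (hY i)
  have hprod : ∀ (m : σ →₀ ℕ) (s : Finset σ) (e : ℕ),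
      (coeff e (∏ i ∈ s, Y i ^ m i)).IsHomogeneous (∑ i ∈ s, m i) := fun m s => by
    induction s using Finset.induction_on with
    | empty => simpa only [Finset.prod_empty, Finset.sum_empty] using hone
    | insert a s ha ih =>
      rw [Finset.prod_insert ha, Finset.sum_insert ha]
      exact hmul (hpow a _) ih
  rw [MvPolynomial.eval₂_eq, map_sum]
  refine MvPolynomial.IsHomogeneous.sum _ _ _ fun m hm => ?_
  have h := hmul (m := 0) (A := map MvPolynomial.C (g.coeff m)) (fun e => by
    rw [coeff_map]
    exact MvPolynomial.isHomogeneous_C _ _) (hprod m m.support) e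
  rw [zero_add] at h
  have hdeg : ∑ i ∈ m.support, m i = d := by
    rw [← hg (MvPolynomial.mem_support_iff.1 hm), Finsupp.weight_apply, Finsupp.sum]
    simp
  rwa [hdeg] at h

lemma exists_primitive_dvd {p : ℕ} [Fact p.Prime] [Fintype σ] {d : ℕ} (hd : 1 ≤ d)
    (hσ : d ^ 2 < Fintype.card σ) {g : MvPolynomial σ (PowerSeries (ZMod p))}
    (hg : g.IsHomogeneous d) (N : ℕ) :
    ∃ y : σ → PowerSeries (ZMod p), (∃ i, constantCoeff (y i) ≠ 0) ∧
      X ^ N ∣ MvPolynomial.eval y g := by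
  classical
  set s := d * N with hs
  let τ := σ × Fin (s + 1)
  let Y : σ → PowerSeries (MvPolynomial τ (ZMod p)) := fun i =>
    mk fun e => if h : e < s + 1 then MvPolynomial.X (i, ⟨e, h⟩) else 0
  have hY : ∀ i e, (coeff e (Y i)).IsHomogeneous 1 := fun i e => by
    simp only [Y, coeff_mk]
    split_ifs
    · exact MvPolynomial.isHomogeneous_X _ _
    · exact MvPolynomial.isHomogeneous_zero _ _ _
  let G : ℕ → MvPolynomial τ (ZMod p) := fun e => coeff e (g.eval₂ (map MvPolynomial.C) Y)
  have hG : ∀ e, (G e).IsHomogeneous d := isHomogeneous_coeff_eval₂ Y hY hg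
  have hsum : ∑ e ∈ Finset.range (N + d * s), (G e).totalDegree < Fintype.card τ := by
    refine (Finset.sum_le_card_nsmul _ _ d fun e _ => (hG e).totalDegree_le).trans_lt ?_
    rw [Finset.card_range, Fintype.card_prod, Fintype.card_fin, smul_eq_mul]
    nlinarith
  have hcw := char_dvd_card_solutions_of_sum_lt p hsum
  have h0 : ∀ e ∈ Finset.range (N + d * s), MvPolynomial.eval (0 : τ → ZMod p) (G e) = 0 :=
    fun e _ => by
      rw [MvPolynomial.eval_zero, MvPolynomial.constantCoeff_eq]
      exact (hG e).coeff_eq_zero (by simp; omega)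
  obtain ⟨⟨z, hz⟩, hz0⟩ := Fintype.exists_ne_of_one_lt_card
    ((Fact.out : p.Prime).one_lt.trans_le (Nat.le_of_dvd (Fintype.card_pos_iff.2 ⟨⟨0, h0⟩⟩) hcw))
    ⟨0, h0⟩
  replace hz0 : z ≠ 0 := fun h => hz0 (Subtype.ext h)
  let y : σ → PowerSeries (ZMod p) := fun i => map (MvPolynomial.eval z) (Y i)
  have hyG : ∀ e, coeff e (MvPolynomial.eval y g) = MvPolynomial.eval z (G e) := fun e => by
    simp only [G]
    have hid : (map (MvPolynomial.eval z)).comp (map MvPolynomial.C) =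
        RingHom.id (PowerSeries (ZMod p)) := by
      ext x n
      simp
    rw [← coeff_map, MvPolynomial.hom_eval₂, hid]
    rfl
  have hyd : X ^ (N + d * s) ∣ MvPolynomial.eval y g :=
    X_pow_dvd_iff.2 fun e he => by rw [hyG, hz e (Finset.mem_range.2 he)]
  have hex : ∃ r, r ≤ s ∧ ∃ i, coeff r (y i) ≠ 0 := by
    obtain ⟨⟨i, r⟩, hir⟩ := Function.ne_iff.1 hz0
    refine ⟨r, Nat.lt_succ_iff.1 r.2, i, ?_⟩
    simp only [y, Y, coeff_map, coeff_mk, dif_pos r.2, MvPolynomial.eval_X]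
    exact hir
  obtain ⟨hrs, i, hi⟩ := Nat.find_spec hex
  set r := Nat.find hex
  have hdiv : ∀ i, X ^ r ∣ y i := fun i => X_pow_dvd_iff.2 fun e he => by
    by_contra hne
    exact Nat.find_min hex he ⟨by omega, i, hne⟩
  choose y' hy' using hdiv
  refine ⟨y', ⟨i, ?_⟩, ?_⟩
  · have := coeff_X_pow_mul (y' i) r 0
    rw [← hy', zero_add] at this
    rwa [← coeff_zero_eq_constantCoeff_apply, ← this]
  · have hy : y = fun i => X ^ r * y' i := funext hy'
    have hsplit : N + d * s = r * d + (N + d * (s - r)) := by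
      obtain ⟨t, ht⟩ := Nat.exists_eq_add_of_le hrs
      rw [ht, Nat.add_sub_cancel_left]
      ring
    rw [hy, hg.eval_mul, hsplit, pow_add, ← pow_mul] at hyd
    exact (pow_dvd_pow X (Nat.le_add_right _ _)).trans
      ((mul_dvd_mul_iff_left (pow_ne_zero _ X_ne_zero)).1 hyd)

lemma exists_zero {p : ℕ} [Fact p.Prime] [Fintype σ] {d : ℕ} (hd : 1 ≤ d)
    (hσ : d ^ 2 < Fintype.card σ) {g : MvPolynomial σ (PowerSeries (ZMod p))}
    (hg : g.IsHomogeneous d) :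
    ∃ y : σ → PowerSeries (ZMod p), y ≠ 0 ∧ MvPolynomial.eval y g = 0 := by
  choose y hy hyd using exists_primitive_dvd hd hσ hg
  have hlim : ∀ i e, ∃ c, ∀ᶠ N in hyperfilter ℕ, coeff e (y N i) = c := fun i e =>
    Ultrafilter.eventually_exists_iff.1 (Eventually.of_forall fun N => ⟨_, rfl⟩)
  choose c hc using hlim
  have hconst : ∃ i, c i 0 ≠ 0 := by
    obtain ⟨i, hi⟩ := (Ultrafilter.eventually_exists_iff (f := hyperfilter ℕ)).1
      (Eventually.of_forall hy)
    obtain ⟨N, h1, h2⟩ := (hi.and (hc i 0)).exists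
    exact ⟨i, by rwa [← h2, coeff_zero_eq_constantCoeff_apply]⟩
  obtain ⟨i, hi⟩ := hconst
  refine ⟨fun i => mk (c i), fun h => hi ?_, ?_⟩
  · have := congrArg (coeff 0) (congrFun h i)
    rwa [coeff_mk] at this
  · ext M
    have hM : X ^ (M + 1) ∣ MvPolynomial.eval (fun i => mk (c i)) g := by
      have h1 : ∀ᶠ N in hyperfilter ℕ, ∀ i, ∀ e ∈ Finset.range (M + 1),
          coeff e (y N i) = c i e := by
        rw [eventually_all]
        intro i
        rw [eventually_all_finset]
        exact fun e _ => hc i e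
      have h2 : ∀ᶠ N in hyperfilter ℕ, M + 1 ≤ N := Nat.hyperfilter_le_atTop (eventually_ge_atTop _)
      obtain ⟨N, h3, h4⟩ := (h1.and h2).exists
      have h5 := (pow_dvd_pow X h4).trans (hyd N)
      rw [← Ideal.mem_span_singleton, ← Ideal.Quotient.eq_zero_iff_mem] at h5 ⊢
      rw [← h5, MvPolynomial.eval₂_comp, MvPolynomial.eval₂_comp]
      congr 1
      ext i
      rw [Function.comp_apply, Function.comp_apply, Ideal.Quotient.eq,
        Ideal.mem_span_singleton, X_pow_dvd_iff]
      intro e he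
      rw [map_sub, h3 i e (Finset.mem_range.2 he), coeff_mk, sub_self]
    exact X_pow_dvd_iff.1 hM M M.lt_succ_self

end PowerSeries

lemma LaurentSeries.exists_zero {p : ℕ} [Fact p.Prime] {σ : Type*} [Fintype σ] {d : ℕ} (hd : 1 ≤ d)
    (hσ : d ^ 2 < Fintype.card σ) {f : MvPolynomial σ (LaurentSeries (ZMod p))}
    (hf : f.IsHomogeneous d) :
    ∃ y : σ → LaurentSeries (ZMod p), y ≠ 0 ∧ MvPolynomial.eval y f = 0 := by
  classical
  obtain ⟨b, hb⟩ := IsLocalization.exist_integer_multiples_of_finset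
    (nonZeroDivisors (PowerSeries (ZMod p))) (f.support.image f.coeff)
  choose! a ha using hb
  let g : MvPolynomial σ (PowerSeries (ZMod p)) :=
    ∑ m ∈ f.support, MvPolynomial.monomial m (a (f.coeff m))
  have hg : g.IsHomogeneous d := MvPolynomial.IsHomogeneous.sum _ _ _ fun m hm =>
    MvPolynomial.isHomogeneous_monomial _ (by
      rw [← hf (MvPolynomial.mem_support_iff.1 hm), Finsupp.degree_eq_weight_one]
      rfl)
  have hgf : g.map (algebraMap _ (LaurentSeries (ZMod p))) =
      MvPolynomial.C (algebraMap _ (LaurentSeries (ZMod p)) (b : PowerSeries (ZMod p))) * f := by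
    conv_rhs => rw [f.as_sum, Finset.mul_sum]
    rw [map_sum]
    refine Finset.sum_congr rfl fun m hm => ?_
    rw [MvPolynomial.map_monomial, ha _ (Finset.mem_image_of_mem _ hm), MvPolynomial.C_mul_monomial,
      Algebra.smul_def]
  obtain ⟨y, hy, hy0⟩ := PowerSeries.exists_zero hd hσ hg
  have hinj := IsFractionRing.injective (PowerSeries (ZMod p)) (LaurentSeries (ZMod p))
  refine ⟨fun i => algebraMap _ _ (y i), fun h => hy ?_, ?_⟩
  · ext1 i
    exact hinj ((congrFun h i).trans (map_zero _).symm)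
  · have h1 := congrArg (MvPolynomial.eval fun i => algebraMap _ (LaurentSeries (ZMod p)) (y i)) hgf
    rw [MvPolynomial.eval_map, map_mul, MvPolynomial.eval_C] at h1
    have h2 := (MvPolynomial.eval₂_comp (algebraMap _ (LaurentSeries (ZMod p))) y g).symm.trans
      ((congrArg _ hy0).trans (map_zero _))
    have h3 := mul_eq_zero.1 (h1.symm.trans h2)
    exact h3.resolve_left fun h => nonZeroDivisors.ne_zero b.2 (hinj (h.trans (map_zero _).symm))

namespace MvPolynomial

variable {σ R : Type*} [Fintype σ] [CommRing R]

open Classical in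
/-- The form of degree `d` with given coefficients. -/
noncomputable def form (d : ℕ) (c : (σ →₀ ℕ) → R) : MvPolynomial σ R :=
  ∑ m ∈ Finset.finsuppAntidiag Finset.univ d, monomial m (c m)

lemma isHomogeneous_form (d : ℕ) (c : (σ →₀ ℕ) → R) : (form d c).IsHomogeneous d := by
  classical
  refine IsHomogeneous.sum _ _ _ fun m hm => isHomogeneous_monomial _ ?_
  rw [Finsupp.degree_eq_sum]
  convert! (Finset.mem_finsuppAntidiag.1 hm).1

lemma map_form {S : Type*} [CommRing S] (φ : R →+* S) (d : ℕ) (c : (σ →₀ ℕ) → R) :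
    map φ (form d c) = form d fun m => φ (c m) := by
  simp only [form, map_sum, map_monomial]

lemma IsHomogeneous.eq_form {f : MvPolynomial σ R} {d : ℕ} (hf : f.IsHomogeneous d) :
    f = form d f.coeff := by
  classical
  conv_lhs => rw [f.as_sum]
  refine Finset.sum_subset (fun m hm => ?_) fun m _ hm => ?_
  · rw [Finset.mem_finsuppAntidiag]
    refine ⟨?_, Finset.subset_univ _⟩
    rw [← hf (mem_support_iff.1 hm), Finsupp.weight_apply, Finsupp.sum_fintype _ _ (by simp)]
    simp
  · rw [notMem_support_iff.1 hm, monomial_zero]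

end MvPolynomial

section Transfer

open UProd

variable {U : Ultrafilter ℕ} {σ : Type} [Fintype σ] {d : ℕ}

lemma UProd.exists_zero {F : ℕ → Type} [∀ j, Field (F j)]
    (h : ∀ j, ∀ g : MvPolynomial σ (F j), g.IsHomogeneous d →
      ∃ y : σ → F j, y ≠ 0 ∧ MvPolynomial.eval y g = 0)
    {g : MvPolynomial σ (UProd U F)} (hg : g.IsHomogeneous d) :
    ∃ y : σ → UProd U F, y ≠ 0 ∧ MvPolynomial.eval y g = 0 := by
  let H : MvPolynomial σ (∀ j, F j) := MvPolynomial.form d fun m => (g.coeff m).rep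
  have hH : H.map (ofPi U) = g := by
    rw [MvPolynomial.map_form]
    simp only [ofPi_rep]
    exact hg.eq_form.symm
  choose y hy hy0 using fun j => h j (H.map (Pi.evalRingHom _ j))
    ((MvPolynomial.isHomogeneous_form d _).map _)
  refine ⟨fun s => ofPi U fun j => y j s, fun h => ?_, ?_⟩
  · have h1 : ∀ᶠ j in U, ∀ s, y j s = 0 :=
      eventually_all.2 fun s => ofPi_eq_zero.1 (congrFun h s)
    obtain ⟨j, hj⟩ := h1.exists
    exact hy j (funext hj)
  · rw [← hH, mvEval_map_ofPi, ofPi_eq_zero]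
    exact Eventually.of_forall hy0

lemma AngularField.exists_zero_ultra {F F' k : ℕ → Type} [∀ j, Field (F j)]
    [∀ j, Field (F' j)] [∀ j, Field (k j)] {Γ : Type} [LinearOrderedCommGroupWithZero Γ]
    (D : ∀ j, AngularField (F j) (k j) Γ) (E : ∀ j, AngularField (F' j) (k j) Γ)
    (hU : (U : Filter ℕ) ≤ atTop) [CharZero (UProd U k)]
    (h : ∀ g : MvPolynomial σ (UProd U F'), g.IsHomogeneous d →
      ∃ y : σ → UProd U F', y ≠ 0 ∧ MvPolynomial.eval y g = 0)
    {f : MvPolynomial σ (UProd U F)} (hf : f.IsHomogeneous d) :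
    ∃ x : σ → UProd U F, x ≠ 0 ∧ MvPolynomial.eval x f = 0 := by
  have h1 := exists_zero_transfer (ultra (U := U) D) (ultra E) (ultra_saturated D hU)
    (ultra_saturated E hU) f
  have h2 := fun g (hg : g.support ⊆ f.support) => h g fun m hm =>
    hf (MvPolynomial.mem_support_iff.1 (hg (MvPolynomial.mem_support_iff.2 hm)))
  exact h1 h2

/-- If all forms of degree `d` over a sequence of fields `F' j` are isotropic, then any sequence of
such forms over fields `F j` with the same residue fields and value groups contains an isotropic
one, provided the residue characteristic is zero in the limit. -/
theorem AngularField.exists_zero_of_sequence {F F' k : ℕ → Type} [∀ j, Field (F j)]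
    [∀ j, Field (F' j)] [∀ j, Field (k j)] {Γ : Type} [LinearOrderedCommGroupWithZero Γ]
    (D : ∀ j, AngularField (F j) (k j) Γ) (E : ∀ j, AngularField (F' j) (k j) Γ)
    (hU : (U : Filter ℕ) ≤ atTop) [CharZero (UProd U k)]
    (h : ∀ j, ∀ g : MvPolynomial σ (F' j), g.IsHomogeneous d →
      ∃ y : σ → F' j, y ≠ 0 ∧ MvPolynomial.eval y g = 0)
    (f : ∀ j, MvPolynomial σ (F j)) (hf : ∀ j, (f j).IsHomogeneous d) :
    ∃ j, ∃ x : σ → F j, x ≠ 0 ∧ MvPolynomial.eval x (f j) = 0 := by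
  let G : MvPolynomial σ (∀ j, F j) := MvPolynomial.form d fun m j => (f j).coeff m
  have hG : ∀ j, G.map (Pi.evalRingHom _ j) = f j := fun j => by
    rw [MvPolynomial.map_form]
    exact (hf j).eq_form.symm
  have hGU : (G.map (ofPi U)).IsHomogeneous d := (MvPolynomial.isHomogeneous_form _ _).map _
  obtain ⟨x, hx, hx0⟩ := exists_zero_ultra D E hU (fun g => UProd.exists_zero h) hGU
  obtain ⟨s, hs⟩ := Function.ne_iff.1 hx
  have h1 : ∀ᶠ j in U, (x s).rep j ≠ 0 := Ultrafilter.eventually_not.2 fun h =>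
    hs ((ofPi_rep _).symm.trans (ofPi_eq_zero.2 h))
  have h2 : ∀ᶠ j in U, MvPolynomial.eval (fun s => (x s).rep j) (f j) = 0 := by
    have h3 := mvEval_map_ofPi (U := U) G fun s => (x s).rep
    simp only [ofPi_rep, hG] at h3
    exact ofPi_eq_zero.1 (h3.symm.trans hx0)
  obtain ⟨j, h4, h5⟩ := (h1.and h2).exists
  exact ⟨j, _, fun h => h4 (congrFun h s), h5⟩

/-- Any sequence of forms of degree `d` in more than `d ^ 2` variables over `p`-adic fields, with
`p` tending to infinity, contains an isotropic one. -/
theorem Padic.exists_zero_of_sequence (hd : 1 ≤ d) (hσ : d ^ 2 < Fintype.card σ) (q : ℕ → ℕ)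
    [∀ j, Fact (q j).Prime] (hq : ∀ j, j ≤ q j)
    (f : ∀ j, MvPolynomial σ ℚ_[q j]) (hf : ∀ j, (f j).IsHomogeneous d) :
    ∃ j, ∃ x : σ → ℚ_[q j], x ≠ 0 ∧ MvPolynomial.eval x (f j) = 0 := by
  have hU : (hyperfilter ℕ : Filter ℕ) ≤ atTop := Nat.hyperfilter_le_atTop
  have : CharZero (UProd (hyperfilter ℕ) fun j => ZMod (q j)) := UProd.charZero fun n hn => by
    filter_upwards [hU (eventually_ge_atTop (n + 1))] with j hj h0
    have h1 := Nat.le_of_dvd (Nat.pos_of_ne_zero hn) ((ZMod.natCast_eq_zero_iff _ _).1 h0)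
    have h2 := hq j
    omega
  exact AngularField.exists_zero_of_sequence
    (fun j => (AngularField.nonempty_padic (q j)).some)
    (fun j => (AngularField.nonempty_laurentSeries (ZMod (q j))).some) hU
    (fun j g hg => LaurentSeries.exists_zero hd hσ hg) f hf

end Transfer

/-- A form has a nontrivial zero as soon as all forms of the same degree in fewer variables do. -/
lemma MvPolynomial.IsHomogeneous.exists_zero_of_le {K : Type*} [Field K] {d m n : ℕ} (hmn : m ≤ n)
    (h : ∀ g : MvPolynomial (Fin m) K, g.IsHomogeneous d →
      ∃ x : Fin m → K, x ≠ 0 ∧ MvPolynomial.eval x g = 0)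
    {f : MvPolynomial (Fin n) K} (hf : f.IsHomogeneous d) :
    ∃ x : Fin n → K, x ≠ 0 ∧ MvPolynomial.eval x f = 0 := by
  let Y : Fin n → MvPolynomial (Fin m) K := fun i => if hi : i < m then X ⟨i, hi⟩ else 0
  have hY : ∀ i, (Y i).IsHomogeneous 1 := fun i => by
    simp only [Y]
    split_ifs
    · exact isHomogeneous_X _ _
    · exact isHomogeneous_zero _ _ _
  obtain ⟨x, hx, hx0⟩ := h (MvPolynomial.eval₂ C Y f) (by
    simpa using hf.eval₂ C Y (fun r => isHomogeneous_C _ r) hY)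
  refine ⟨fun i => MvPolynomial.eval x (Y i), fun h0 => hx ?_, ?_⟩
  · ext1 i
    have h1 := congrFun h0 (Fin.castLE hmn i)
    simpa [Y] using h1
  · have hC : (MvPolynomial.eval x).comp C = RingHom.id K := by
      ext
      simp
    rwa [hom_eval₂, hC] at hx0

end Forms

/-- **Ax–Kochen theorem**. For every degree `d ≥ 1` there is a bound `N` such that for all
primes `p ≥ N`, every homogeneous polynomial of degree `d` in `n+1 ≥ d² + 1` variables
over `ℚ_p` has a nontrivial zero. -/
theorem ax_kochen (d : ℕ) (hd : 1 ≤ d) :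
    ∃ N : ℕ, ∀ (p : ℕ) [Fact p.Prime], N ≤ p →
      ∀ n : ℕ, d ^ 2 ≤ n →
        ∀ f : MvPolynomial (Fin (n + 1)) ℚ_[p], f.IsHomogeneous d →
          ∃ x : Fin (n + 1) → ℚ_[p], x ≠ 0 ∧ MvPolynomial.eval x f = 0 := by
  suffices h : ∃ N : ℕ, ∀ (p : ℕ) [Fact p.Prime], N ≤ p →
      ∀ g : MvPolynomial (Fin (d ^ 2 + 1)) ℚ_[p], g.IsHomogeneous d →
        ∃ x : Fin (d ^ 2 + 1) → ℚ_[p], x ≠ 0 ∧ MvPolynomial.eval x g = 0 by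
    obtain ⟨N, hN⟩ := h
    exact ⟨N, fun p _ hp n hn f hf => hf.exists_zero_of_le (Nat.succ_le_succ hn) (hN p hp)⟩
  by_contra! h
  choose q hprime hq f hf hbad using h
  obtain ⟨j, x, hx, hx0⟩ := Padic.exists_zero_of_sequence hd (by simp) q hq f hf
  exact hbad j x hx hx0
end
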